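/- Let Σ(A,B,C,G) be a C^∞-BIBO stable system node with finite-dimensional input and output spaces. Then there exists a Borel measure h of bounded total variation on [0,∞) with values in the d_Y × d_U complex matrices such that for every classical solution (u,x,y) with x(0) = 0 (where u is merely continuous, not necessarily smooth or compactly supported) one has y = h ∗ u, and consequently ‖y‖_{L^∞([0,T],Y)} ≤ ‖h‖_M ‖u‖_{L^∞([0,T],U)} for all T ≥ 0. -/

import Mathlib

/-- A bundled complex Banach space (declared before `open MeasureTheory`, whose
notations interfere with instance-binder fields in structures). -/
structure CplxBanach where
  carrier : Type
  [nacg : NormedAddCommGroup carrier]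
  [nsp : NormedSpace ℂ carrier]
  [cs : CompleteSpace carrier]

attribute [instance] CplxBanach.nacg CplxBanach.nsp CplxBanach.cs

/-- A bundled complex Hilbert space. -/
structure CplxHilbert where
  carrier : Type
  [nacg : NormedAddCommGroup carrier]
  [ips : InnerProductSpace ℂ carrier]
  [cs : CompleteSpace carrier]

attribute [instance] CplxHilbert.nacg CplxHilbert.ips CplxHilbert.cs

open MeasureTheory Set
open scoped ENNReal NNReal Topology

noncomputable section

/-- A strongly continuous semigroup of bounded linear operators on a complex Banach space. -/
structure C0Semigroup (X : Type*) [NormedAddCommGroup X] [NormedSpace ℂ X] where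
  T : ℝ → X →L[ℂ] X
  map_zero : T 0 = ContinuousLinearMap.id ℂ X
  map_add : ∀ s t : ℝ, 0 ≤ s → 0 ≤ t → T (s + t) = (T s).comp (T t)
  strongly_continuous : ∀ x : X, ContinuousOn (fun t => T t x) (Set.Ici 0)

namespace C0Semigroup

variable {X : Type*} [NormedAddCommGroup X] [NormedSpace ℂ X]

/-- The growth bound `ω(T)` of a strongly continuous semigroup. -/
def growthBound (S : C0Semigroup X) : ℝ :=
  sInf {w : ℝ | ∃ M : ℝ, ∀ t : ℝ, 0 ≤ t → ‖S.T t‖ ≤ M * Real.exp (w * t)}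

/-- Exponential stability of a strongly continuous semigroup. -/
def ExpStable (S : C0Semigroup X) : Prop :=
  ∃ ε : ℝ, 0 < ε ∧ ∃ M : ℝ, ∀ t : ℝ, 0 ≤ t → ‖S.T t‖ ≤ M * Real.exp (-ε * t)

/-- The semigroup is analytic: it extends analytically to an open sector around the
positive real axis, the extension satisfying the semigroup property on the sector. -/
def IsAnalytic (S : C0Semigroup X) : Prop :=
  ∃ θ : ℝ, θ ∈ Set.Ioo 0 (Real.pi / 2) ∧ ∃ F : ℂ → X →L[ℂ] X,
    DifferentiableOn ℂ F {z : ℂ | z ≠ 0 ∧ |Complex.arg z| < θ} ∧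
    (∀ t : ℝ, 0 < t → F t = S.T t) ∧
    (∀ z w : ℂ, (z ≠ 0 ∧ |Complex.arg z| < θ) → (w ≠ 0 ∧ |Complex.arg w| < θ) →
      F (z + w) = (F z).comp (F w))

/-- The fractional power `(-A)^{-γ}` of the negative generator of an exponentially
stable semigroup, defined through the standard integral formula
`(-A)^{-γ} = Γ(γ)⁻¹ ∫_0^∞ t^{γ-1} T(t) dt` (and the identity for `γ = 0`). -/
def negAPow (S : C0Semigroup X) (γ : ℝ) : X →L[ℂ] X :=
  if γ = 0 then ContinuousLinearMap.id ℂ X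
  else (Real.Gamma γ)⁻¹ • ∫ t in Set.Ioi (0:ℝ), t ^ (γ - 1) • S.T t

end C0Semigroup

/-- A system node `Σ(A,B,C,G)` on the Banach spaces `(U, X, Y)`, in the sense of Staffans.
The extrapolation space `X_{-1}` is given as the space `Xm1` together with a dense
continuous embedding `ι : X → X_{-1}`; `Am1 : X → X_{-1}` is the extension
`A_{-1}` of the generator restricted to `X` (which is bounded from `X` to `X_{-1}`);
the domain of `A` is the set of `x ∈ X` with `A_{-1} x ∈ X`.  `R s` is the resolvent
`(s - A_{-1})^{-1} : X_{-1} → X`, defined (as specified by `R_right`, `R_left`) for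
`Re s > ω(T)`.  `B : U → X_{-1}` is the control operator and `Cop` is the observation
operator `C : X_1 → Y`, encoded as a map on all of `X` that is linear and
`X_1`-bounded on the domain of `A`.  `G` is the transfer function. -/
structure SystemNode (U : Type*) (X : Type*) (Xm1 : Type*) (Y : Type*)
    [NormedAddCommGroup U] [NormedSpace ℂ U]
    [NormedAddCommGroup X] [NormedSpace ℂ X]
    [NormedAddCommGroup Xm1] [NormedSpace ℂ Xm1]
    [NormedAddCommGroup Y] [NormedSpace ℂ Y] where
  S : C0Semigroup X
  Sm1 : C0Semigroup Xm1
  ι : X →L[ℂ] Xm1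
  ι_injective : Function.Injective (fun x : X => ι x)
  ι_dense : DenseRange (fun x : X => ι x)
  semigroup_compat : ∀ t : ℝ, 0 ≤ t → ∀ x : X, Sm1.T t (ι x) = ι (S.T t x)
  Am1 : X →L[ℂ] Xm1
  generator : ∀ x : X, ∀ t : ℝ, 0 ≤ t →
    HasDerivWithinAt (fun τ : ℝ => ι (S.T τ x)) (Am1 (S.T t x)) (Set.Ici 0) t
  B : U →L[ℂ] Xm1
  Cop : X → Y
  Cop_add : ∀ x₁ x₂ : X, (∃ z : X, Am1 x₁ = ι z) → (∃ z : X, Am1 x₂ = ι z) →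
    Cop (x₁ + x₂) = Cop x₁ + Cop x₂
  Cop_smul : ∀ (a : ℂ) (x : X), (∃ z : X, Am1 x = ι z) → Cop (a • x) = a • Cop x
  Cop_bound : ∃ M : ℝ, ∀ x z : X, Am1 x = ι z → ‖Cop x‖ ≤ M * (‖x‖ + ‖z‖)
  R : ℂ → Xm1 →L[ℂ] X
  R_right : ∀ s : ℂ, S.growthBound < s.re → ∀ w : Xm1, s • ι (R s w) - Am1 (R s w) = w
  R_left : ∀ s : ℂ, S.growthBound < s.re → ∀ x : X, R s (s • ι x - Am1 x) = x
  G : ℂ → U →L[ℂ] Y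
  G_analytic : DifferentiableOn ℂ (fun s => G s) {s : ℂ | S.growthBound < s.re}
  G_shift : ∀ α β : ℂ, S.growthBound < α.re → S.growthBound < β.re → ∀ u : U,
    G α u - G β u = Cop (R α (B u) - R β (B u))

namespace SystemNode

variable {U X Xm1 Y : Type*}
  [NormedAddCommGroup U] [NormedSpace ℂ U]
  [NormedAddCommGroup X] [NormedSpace ℂ X]
  [NormedAddCommGroup Xm1] [NormedSpace ℂ Xm1]
  [NormedAddCommGroup Y] [NormedSpace ℂ Y]

/-- The domain of the generator `A`: those `x ∈ X` with `A_{-1} x ∈ X`. -/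
def domA (sys : SystemNode U X Xm1 Y) : Set X := {x : X | ∃ z : X, sys.Am1 x = sys.ι z}

/-- A fixed point in the half-plane of analyticity of the transfer function. -/
def betaPt (sys : SystemNode U X Xm1 Y) : ℂ := ((sys.S.growthBound + 1 : ℝ) : ℂ)

/-- The combined observation/feedthrough operator
`C&D (x,u) = C[x - (β - A)⁻¹ B u] + G(β) u`. -/
def CD (sys : SystemNode U X Xm1 Y) (x : X) (u : U) : Y :=
  sys.Cop (x - sys.R sys.betaPt (sys.B u)) + sys.G sys.betaPt u

/-- The pair `(x,u)` belongs to the domain of the combined operator `C&D`,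
i.e. `A_{-1} x + B u ∈ X`. -/
def memCD (sys : SystemNode U X Xm1 Y) (x : X) (u : U) : Prop :=
  ∃ z : X, sys.Am1 x + sys.B u = sys.ι z

/-- A classical solution `(u,x,y)` of the system node on `[0,∞)`:
`u, y` continuous, `x` continuously differentiable with
`ẋ(t) = A x(t) + B u(t)` (in particular `(x(t),u(t)) ∈ D(C&D)`) and
`y(t) = C&D (x(t),u(t))` for all `t ≥ 0`. -/
def IsClassicalSolution (sys : SystemNode U X Xm1 Y)
    (u : ℝ → U) (x : ℝ → X) (y : ℝ → Y) : Prop :=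
  ContinuousOn u (Set.Ici 0) ∧ ContinuousOn y (Set.Ici 0) ∧
  (∃ x' : ℝ → X, ContinuousOn x' (Set.Ici 0) ∧
    (∀ t ∈ Set.Ici (0:ℝ), HasDerivWithinAt x (x' t) (Set.Ici 0) t) ∧
    (∀ t ∈ Set.Ici (0:ℝ), sys.Am1 (x t) + sys.B (u t) = sys.ι (x' t))) ∧
  (∀ t ∈ Set.Ici (0:ℝ), y t = sys.CD (x t) (u t))

/-- `C^∞`-BIBO stability: there is `c > 0` such that every classical solution with
zero initial state and smooth input compactly supported in `(0,∞)` has output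
bounded by `c` times the sup-norm of the input. -/
def CInfBIBOStable (sys : SystemNode U X Xm1 Y) : Prop :=
  ∃ c : ℝ, 0 < c ∧ ∀ (u : ℝ → U) (x : ℝ → X) (y : ℝ → Y),
    sys.IsClassicalSolution u x y → x 0 = 0 →
    ContDiff ℝ (⊤ : ℕ∞) u → HasCompactSupport u → tsupport u ⊆ Set.Ioi 0 →
    ∀ M : ℝ, (∀ s : ℝ, ‖u s‖ ≤ M) → ∀ t : ℝ, 0 ≤ t → ‖y t‖ ≤ c * M

/-- The state part of a generalised solution in the distributional sense:
`u ∈ L¹_loc`, `x` continuous `X_{-1}`-valued, given by the variation of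
constants formula with initial state `x₀ ∈ X`. -/
def IsMildState (sys : SystemNode U X Xm1 Y) (x₀ : X) (u : ℝ → U) (xs : ℝ → Xm1) : Prop :=
  MeasureTheory.LocallyIntegrableOn u (Set.Ici 0) ∧
  ContinuousOn xs (Set.Ici 0) ∧
  ∀ t : ℝ, 0 ≤ t →
    IntervalIntegrable (fun s => sys.Sm1.T (t - s) (sys.B (u s))) MeasureTheory.volume 0 t ∧
    xs t = sys.Sm1.T t (sys.ι x₀) + ∫ s in (0:ℝ)..t, sys.Sm1.T (t - s) (sys.B (u s))

/-- The output part of a generalised solution in the distributional sense: the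
(locally integrable representative of the) `Y`-valued distribution
`y = d²/dt² ( C&D ∫_0^t (t-s) (x(s), u(s)) ds )`. -/
def IsGenOutput (sys : SystemNode U X Xm1 Y) (u : ℝ → U) (xs : ℝ → Xm1) (y : ℝ → Y) : Prop :=
  MeasureTheory.LocallyIntegrableOn y (Set.Ici 0) ∧
  ∃ (K : ℝ → X) (L : ℝ → U),
    (∀ t : ℝ, 0 ≤ t → sys.ι (K t) = ∫ s in (0:ℝ)..t, (t - s) • xs s) ∧
    (∀ t : ℝ, 0 ≤ t → L t = ∫ s in (0:ℝ)..t, (t - s) • u s) ∧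
    (∀ t : ℝ, 0 ≤ t → sys.memCD (K t) (L t)) ∧
    (∀ φ : ℝ → ℝ, ContDiff ℝ (⊤ : ℕ∞) φ → HasCompactSupport φ → tsupport φ ⊆ Set.Ioi 0 →
      ∫ t in Set.Ioi (0:ℝ), deriv (deriv φ) t • sys.CD (K t) (L t) =
        ∫ t in Set.Ioi (0:ℝ), φ t • y t)

/-- A generalised solution in the distributional sense. -/
def IsGeneralizedSolution (sys : SystemNode U X Xm1 Y) (x₀ : X)
    (u : ℝ → U) (xs : ℝ → Xm1) (y : ℝ → Y) : Prop :=
  sys.IsMildState x₀ u xs ∧ sys.IsGenOutput u xs y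

/-- `L^∞`-BIBO stability: there is `c > 0` such that for every generalised solution in
the distributional sense with zero initial state and locally essentially bounded input,
the output is represented by a locally essentially bounded function with
`‖y‖_{L^∞([0,t])} ≤ c ‖u‖_{L^∞([0,t])}` for all `t > 0`. -/
def LInfBIBOStable (sys : SystemNode U X Xm1 Y) : Prop :=
  ∃ c : ℝ, 0 < c ∧ ∀ (u : ℝ → U) (xs : ℝ → Xm1),
    sys.IsMildState 0 u xs →
    (∀ t : ℝ, 0 < t → ∃ M : ℝ,
      ∀ᵐ s ∂(MeasureTheory.volume.restrict (Set.Ioc (0:ℝ) t)), ‖u s‖ ≤ M) →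
    ∃ y : ℝ → Y, sys.IsGenOutput u xs y ∧
      ∀ t : ℝ, 0 < t → ∀ M : ℝ,
        (∀ᵐ s ∂(MeasureTheory.volume.restrict (Set.Ioc (0:ℝ) t)), ‖u s‖ ≤ M) →
        (∀ᵐ s ∂(MeasureTheory.volume.restrict (Set.Ioc (0:ℝ) t)), ‖y s‖ ≤ c * M)

/-- `L^p`-control-admissibility of the control operator `B`. -/
def ControlAdmissible (sys : SystemNode U X Xm1 Y) (p : ℝ≥0∞) : Prop :=
  ∀ t : ℝ, 0 < t → ∃ M : ℝ, ∀ u : ℝ → U,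
    IntervalIntegrable (fun s => sys.Sm1.T (t - s) (sys.B (u s))) MeasureTheory.volume 0 t →
    ∃ x : X, sys.ι x = ∫ s in (0:ℝ)..t, sys.Sm1.T (t - s) (sys.B (u s)) ∧
      ‖x‖ ≤ M * (eLpNorm u p (MeasureTheory.volume.restrict (Set.Ioc (0:ℝ) t))).toReal

/-- Infinite-time `L^p`-control-admissibility: the admissibility constant can be chosen
uniformly in `t`. -/
def InfTimeControlAdmissible (sys : SystemNode U X Xm1 Y) (p : ℝ≥0∞) : Prop :=
  ∃ M : ℝ, ∀ t : ℝ, 0 < t → ∀ u : ℝ → U,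
    IntervalIntegrable (fun s => sys.Sm1.T (t - s) (sys.B (u s))) MeasureTheory.volume 0 t →
    ∃ x : X, sys.ι x = ∫ s in (0:ℝ)..t, sys.Sm1.T (t - s) (sys.B (u s)) ∧
      ‖x‖ ≤ M * (eLpNorm u p (MeasureTheory.volume.restrict (Set.Ioc (0:ℝ) t))).toReal

/-- `L^p`-observation-admissibility of the observation operator `C`. -/
def ObservationAdmissible (sys : SystemNode U X Xm1 Y) (p : ℝ≥0∞) : Prop :=
  ∃ t : ℝ, 0 < t ∧ ∃ M : ℝ, ∀ x z : X, sys.Am1 x = sys.ι z →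
    (eLpNorm (fun s : ℝ => sys.Cop (sys.S.T s x)) p
      (MeasureTheory.volume.restrict (Set.Ioc (0:ℝ) t))).toReal ≤ M * ‖x‖

/-- `L²`-well-posedness of a system node: `B` and `C` are `L²`-admissible and the
transfer function is bounded on some right half-plane. -/
def L2WellPosed (sys : SystemNode U X Xm1 Y) : Prop :=
  sys.ControlAdmissible 2 ∧ sys.ObservationAdmissible 2 ∧
  ∃ w : ℝ, sys.S.growthBound ≤ w ∧ ∃ M : ℝ, ∀ s : ℂ, w < s.re → ‖sys.G s‖ ≤ M

end SystemNode

/-- A (matrix/operator valued) Borel measure of bounded total variation on `[0,∞)`,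
encoded through its polar decomposition: a finite positive measure `μ` supported on
`[0,∞)` together with a density `g` of norm one. -/
structure BVMeasure (U Y : Type*) [NormedAddCommGroup U] [NormedSpace ℂ U]
    [NormedAddCommGroup Y] [NormedSpace ℂ Y] where
  μ : MeasureTheory.Measure ℝ
  finite : MeasureTheory.IsFiniteMeasure μ
  supported : μ (Set.Iio 0) = 0
  g : ℝ → U →L[ℂ] Y
  g_meas : MeasureTheory.AEStronglyMeasurable g μ
  g_norm : ∀ᵐ t ∂μ, ‖g t‖ = 1

namespace BVMeasure

variable {U Y : Type*} [NormedAddCommGroup U] [NormedSpace ℂ U]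
  [NormedAddCommGroup Y] [NormedSpace ℂ Y]

/-- The total variation `‖h‖_M` of the measure. -/
def var (h : BVMeasure U Y) : ℝ := (h.μ Set.univ).toReal

/-- The Laplace transform `ĥ(s) u = ∫ e^{-st} dh(t) u`. -/
def laplace (h : BVMeasure U Y) (s : ℂ) (u : U) : Y :=
  ∫ t, Complex.exp (-(s * t)) • (h.g t u) ∂h.μ

/-- The convolution `(h ∗ u)(t) = ∫_{[0,t]} dh(s) u(t - s)`. -/
def conv (h : BVMeasure U Y) (u : ℝ → U) (t : ℝ) : Y :=
  ∫ s in Set.Icc 0 t, (h.g s) (u (t - s)) ∂h.μ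

end BVMeasure

/-- The Laplace transform of `h` coincides with the transfer function of the node on
the half-plane `ℂ_{ω(T)}` (on `ℂ_{ω(T)} ∩ ℂ_0`, identifying `ĥ` with its analytic
continuation). -/
def LaplaceMatches {U X Xm1 Y : Type*}
    [NormedAddCommGroup U] [NormedSpace ℂ U]
    [NormedAddCommGroup X] [NormedSpace ℂ X]
    [NormedAddCommGroup Xm1] [NormedSpace ℂ Xm1]
    [NormedAddCommGroup Y] [NormedSpace ℂ Y]
    (sys : SystemNode U X Xm1 Y) (h : BVMeasure U Y) : Prop :=
  ∀ s : ℂ, sys.S.growthBound < s.re → 0 ≤ s.re → ∀ u : U, h.laplace s u = sys.G s u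

/-- `sys'` is a system node for the multiplicatively perturbed triple `(AP, B, C)`. -/
def IsMultPerturbed {U X Xm1 Y : Type*}
    [NormedAddCommGroup U] [NormedSpace ℂ U]
    [NormedAddCommGroup X] [NormedSpace ℂ X]
    [NormedAddCommGroup Xm1] [NormedSpace ℂ Xm1]
    [NormedAddCommGroup Y] [NormedSpace ℂ Y]
    (sys sys' : SystemNode U X Xm1 Y) (P : X →L[ℂ] X) : Prop :=
  sys'.ι = sys.ι ∧ sys'.Am1 = sys.Am1.comp P ∧ sys'.B = sys.B ∧ sys'.Cop = sys.Cop

/-- `sys'` is a system node for the additively perturbed triple `(A + P, B, C)`. -/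
def IsAddPerturbed {U X Xm1 Y : Type*}
    [NormedAddCommGroup U] [NormedSpace ℂ U]
    [NormedAddCommGroup X] [NormedSpace ℂ X]
    [NormedAddCommGroup Xm1] [NormedSpace ℂ Xm1]
    [NormedAddCommGroup Y] [NormedSpace ℂ Y]
    (sys sys' : SystemNode U X Xm1 Y) (P : X →L[ℂ] X) : Prop :=
  sys'.ι = sys.ι ∧ sys'.Am1 = sys.Am1 + sys.ι.comp P ∧ sys'.B = sys.B ∧ sys'.Cop = sys.Cop

end


open BoundedContinuousFunction in
noncomputable def absF (L : (ℝ →ᵇ ℂ) →L[ℂ] ℂ) (f : ℝ → ℝ) : ℝ :=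
  sSup {r : ℝ | ∃ g : ℝ →ᵇ ℂ, (∀ x, ‖g x‖ ≤ f x) ∧ r = ‖L g‖}

open BoundedContinuousFunction in
lemma le_absF (L : (ℝ →ᵇ ℂ) →L[ℂ] ℂ) (f : ℝ → ℝ) (B : ℝ) (hB : ∀ x, f x ≤ B)
    (g : ℝ →ᵇ ℂ) (hg : ∀ x, ‖g x‖ ≤ f x) : ‖L g‖ ≤ absF L f := by
  refine le_csSup ⟨‖L‖ * B, ?_⟩ ⟨g, hg, rfl⟩
  rintro r ⟨g, hg, rfl⟩
  refine (L.le_opNorm g).trans ?_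
  gcongr
  exact (BoundedContinuousFunction.norm_le ((norm_nonneg _).trans ((hg 0).trans (hB 0)))).2
    fun x => (hg x).trans (hB x)

open BoundedContinuousFunction in
lemma absF_le (L : (ℝ →ᵇ ℂ) →L[ℂ] ℂ) (f : ℝ → ℝ) (hf : ∀ x, 0 ≤ f x) (K : ℝ)
    (h : ∀ g : ℝ →ᵇ ℂ, (∀ x, ‖g x‖ ≤ f x) → ‖L g‖ ≤ K) : absF L f ≤ K := by
  refine csSup_le ⟨_, 0, by simpa using hf, rfl⟩ ?_
  rintro r ⟨g, hg, rfl⟩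
  exact h g hg

lemma absF_nonneg (L : (BoundedContinuousFunction ℝ ℂ) →L[ℂ] ℂ) (f : ℝ → ℝ) : 0 ≤ absF L f := by
  refine Real.sSup_nonneg ?_
  rintro r ⟨g, hg, rfl⟩
  positivity

lemma exists_phase (z : ℂ) : ∃ w : ℂ, ‖w‖ = 1 ∧ w * z = ‖z‖ := by
  by_cases h : z = 0
  · exact ⟨1, by simp, by simp [h]⟩
  · refine ⟨‖z‖ / z, ?_, ?_⟩
    · simp [h]
    · field_simp

open BoundedContinuousFunction in
lemma absF_add (L : (ℝ →ᵇ ℂ) →L[ℂ] ℂ) (f₁ f₂ : ℝ → ℝ) (B : ℝ) (h1 : ∀ x, 0 ≤ f₁ x)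
    (h2 : ∀ x, 0 ≤ f₂ x) (hB1 : ∀ x, f₁ x ≤ B) (hB2 : ∀ x, f₂ x ≤ B)
    (c1 : Continuous f₁) (c2 : Continuous f₂) :
    absF L (fun x => f₁ x + f₂ x) = absF L f₁ + absF L f₂ := by
  apply le_antisymm
  · refine absF_le _ _ (fun x => add_nonneg (h1 x) (h2 x)) _ fun g hg => ?_
    refine le_of_forall_pos_le_add fun ε hε => ?_
    obtain ⟨δ, hδ, hδε⟩ : ∃ δ > 0, ‖L‖ * δ ≤ ε := by
      refine ⟨ε / (‖L‖ + 1), by positivity, ?_⟩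
      have : 0 ≤ ‖L‖ := norm_nonneg _
      rw [mul_div_assoc', div_le_iff₀ (by positivity)]
      nlinarith
    have hpos : ∀ x, 0 < f₁ x + f₂ x + δ := fun x => by linarith [h1 x, h2 x]
    have key : ∀ (f : ℝ → ℝ), (∀ x, 0 ≤ f x) → (∀ x, f x ≤ B) → Continuous f →
        ∃ k : ℝ →ᵇ ℂ, (∀ x, k x = g x * ((f x / (f₁ x + f₂ x + δ) : ℝ) : ℂ)) ∧
          ∀ x, ‖k x‖ ≤ f x := by
      intro f hf hfB hfc
      have hb : ∀ x, ‖g x * ((f x / (f₁ x + f₂ x + δ) : ℝ) : ℂ)‖ ≤ f x := by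
        intro x
        rw [norm_mul, Complex.norm_real, Real.norm_of_nonneg (div_nonneg (hf x) (hpos x).le),
          mul_div_assoc', div_le_iff₀ (hpos x)]
        have := hg x
        nlinarith [hf x]
      refine ⟨BoundedContinuousFunction.ofNormedAddCommGroup
        (fun x => g x * ((f x / (f₁ x + f₂ x + δ) : ℝ) : ℂ)) ?_ B
        (fun x => (hb x).trans (hfB x)), fun x => rfl, hb⟩
      refine g.continuous.mul (Complex.continuous_ofReal.comp ?_)
      exact hfc.div ((c1.add c2).add continuous_const) fun x => (hpos x).ne'
    obtain ⟨k1, hk1, hk1'⟩ := key f₁ h1 hB1 c1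
    obtain ⟨k2, hk2, hk2'⟩ := key f₂ h2 hB2 c2
    have hrest : ‖g - k1 - k2‖ ≤ δ := by
      refine (BoundedContinuousFunction.norm_le hδ.le).2 fun x => ?_
      have : (g - k1 - k2) x = g x * ((δ / (f₁ x + f₂ x + δ) : ℝ) : ℂ) := by
        simp only [BoundedContinuousFunction.coe_sub, Pi.sub_apply, hk1, hk2]
        have := (hpos x).ne'
        have h3 : ((f₁ x : ℂ) + f₂ x + δ) ≠ 0 := by exact_mod_cast this
        push_cast
        field_simp
        ring
      rw [this, norm_mul, Complex.norm_real, Real.norm_of_nonneg (div_nonneg hδ.le (hpos x).le),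
          mul_div_assoc', div_le_iff₀ (hpos x)]
      have := hg x
      nlinarith
    have e : L g = L k1 + L k2 + L (g - k1 - k2) := by simp
    rw [e]
    refine (norm_add₃_le).trans ?_
    gcongr
    · exact le_absF L f₁ B hB1 k1 hk1'
    · exact le_absF L f₂ B hB2 k2 hk2'
    · exact (L.le_opNorm _).trans ((by gcongr : ‖L‖ * _ ≤ ‖L‖ * δ).trans hδε)
  · have : ∀ g₁ : ℝ →ᵇ ℂ, (∀ x, ‖g₁ x‖ ≤ f₁ x) → ∀ g₂ : ℝ →ᵇ ℂ, (∀ x, ‖g₂ x‖ ≤ f₂ x) →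
        ‖L g₁‖ + ‖L g₂‖ ≤ absF L (fun x => f₁ x + f₂ x) := by
      intro g₁ hg₁ g₂ hg₂
      obtain ⟨w1, hw1, e1⟩ := exists_phase (L g₁)
      obtain ⟨w2, hw2, e2⟩ := exists_phase (L g₂)
      have := le_absF L (fun x => f₁ x + f₂ x) (B + B) (fun x => add_le_add (hB1 x) (hB2 x))
        (w1 • g₁ + w2 • g₂) (fun x => by
          refine (norm_add_le _ _).trans ?_
          simp only [BoundedContinuousFunction.coe_smul, norm_smul, hw1, hw2, one_mul]
          exact add_le_add (hg₁ x) (hg₂ x))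
      rw [map_add, map_smul, map_smul, smul_eq_mul, smul_eq_mul, e1, e2, ← Complex.ofReal_add,
        Complex.norm_real, Real.norm_of_nonneg (by positivity)] at this
      exact this
    have h3 : absF L f₁ ≤ absF L (fun x => f₁ x + f₂ x) - absF L f₂ := by
      refine absF_le L f₁ h1 _ fun g₁ hg₁ => ?_
      have : absF L f₂ ≤ absF L (fun x => f₁ x + f₂ x) - ‖L g₁‖ :=
        absF_le L f₂ h2 _ fun g₂ hg₂ => by linarith [this g₁ hg₁ g₂ hg₂]
      linarith
    linarith

open BoundedContinuousFunction in
lemma absF_smul_le (L : (ℝ →ᵇ ℂ) →L[ℂ] ℂ) (f : ℝ → ℝ) (B : ℝ) (h1 : ∀ x, 0 ≤ f x)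
    (hB1 : ∀ x, f x ≤ B) (c : ℝ) (hc : 0 < c) :
    absF L (fun x => c * f x) ≤ c * absF L f := by
  refine absF_le _ _ (fun x => mul_nonneg hc.le (h1 x)) _ fun g hg => ?_
  have := le_absF L f B hB1 (((c⁻¹ : ℝ) : ℂ) • g) (fun x => by
    simp only [BoundedContinuousFunction.coe_smul, norm_smul, Complex.norm_real, norm_inv,
      Real.norm_of_nonneg hc.le]
    rw [inv_mul_le_iff₀ hc]; exact hg x)
  rw [map_smul, norm_smul, Complex.norm_real, norm_inv, Real.norm_of_nonneg hc.le,
    inv_mul_le_iff₀ hc] at this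
  exact this

open BoundedContinuousFunction in
lemma absF_smul (L : (ℝ →ᵇ ℂ) →L[ℂ] ℂ) (f : ℝ → ℝ) (B : ℝ) (h1 : ∀ x, 0 ≤ f x)
    (hB1 : ∀ x, f x ≤ B) (c : ℝ) (hc : 0 ≤ c) :
    absF L (fun x => c * f x) = c * absF L f := by
  rcases hc.eq_or_lt with rfl | hc
  · refine le_antisymm ?_ (by simpa using absF_nonneg L _)
    refine absF_le _ _ (by simp) _ fun g hg => ?_
    have : g = 0 := by
      ext x
      simpa using hg x
    simp [this]
  · refine le_antisymm (absF_smul_le L f B h1 hB1 c hc) ?_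
    have := absF_smul_le L (fun x => c * f x) (c * B) (fun x => mul_nonneg hc.le (h1 x))
      (fun x => by gcongr; exact hB1 x) c⁻¹ (by positivity)
    simp only [inv_mul_cancel_left₀ hc.ne'] at this
    rwa [← div_eq_inv_mul, le_div_iff₀ hc, mul_comm] at this

open BoundedContinuousFunction CompactlySupported in
lemma riesz_dom_aux (L : (ℝ →ᵇ ℂ) →L[ℂ] ℂ) :
    ∃ μ : Measure ℝ, IsFiniteMeasure μ ∧ ∀ f : ℝ →ᵇ ℂ, HasCompactSupport f →
      ‖L f‖ ≤ ∫ x, ‖f x‖ ∂μ := by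
  have bdd : ∀ f : C_c(ℝ, ℝ≥0), ∃ B : ℝ, ∀ x, (f x : ℝ) ≤ B := by
    intro f
    obtain ⟨C, hC⟩ := (f.hasCompactSupport.comp_left (g := fun r : ℝ≥0 => (r : ℝ)) rfl
      ).exists_bound_of_continuous (by fun_prop)
    exact ⟨C, fun x => (le_abs_self _).trans (hC x)⟩
  let Λ : C_c(ℝ, ℝ≥0) →ₗ[ℝ≥0] ℝ≥0 :=
    { toFun := fun f => ⟨absF L (fun x => (f x : ℝ)), absF_nonneg _ _⟩
      map_add' := by
        intro f g
        obtain ⟨B, hB⟩ := bdd f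
        obtain ⟨B', hB'⟩ := bdd g
        apply NNReal.eq
        simp only [CompactlySupportedContinuousMap.coe_add, Pi.add_apply, NNReal.coe_add]
        exact absF_add L _ _ (max B B') (fun x => (f x).2) (fun x => (g x).2)
          (fun x => (hB x).trans (le_max_left _ _)) (fun x => (hB' x).trans (le_max_right _ _))
          (by fun_prop) (by fun_prop)
      map_smul' := by
        intro c f
        obtain ⟨B, hB⟩ := bdd f
        apply NNReal.eq
        simp only [CompactlySupportedContinuousMap.coe_smul, Pi.smul_apply, smul_eq_mul,
          NNReal.coe_mul, RingHom.id_apply]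
        exact absF_smul L _ B (fun x => (f x).2) hB c c.2 }
  have hΛ : ∀ f : C_c(ℝ, ℝ≥0), (Λ f : ℝ) = absF L (fun x => (f x : ℝ)) := fun f => rfl
  refine ⟨NNRealRMK.rieszMeasure Λ, ?_, ?_⟩
  · have hK : ∀ n : ℕ, NNRealRMK.rieszMeasure Λ (Icc (-(n:ℝ)) n) ≤ ENNReal.ofReal ‖L‖ := by
      intro n
      obtain ⟨f, hf1, hf0, hfc, hf01⟩ := exists_continuous_one_zero_of_isCompact
        (isCompact_Icc (a := -(n:ℝ)) (b := n)) (isClosed_empty) (disjoint_empty _)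
      let F : C_c(ℝ, ℝ≥0) := ⟨⟨fun x => (f x).toNNReal, by fun_prop⟩,
        hfc.comp_left (g := Real.toNNReal) (by simp)⟩
      have hF : ∀ x, F x = (f x).toNNReal := fun x => rfl
      calc NNRealRMK.rieszMeasure Λ (Icc (-(n:ℝ)) n)
          = ∫⁻ x in Icc (-(n:ℝ)) n, 1 ∂NNRealRMK.rieszMeasure Λ := by simp
        _ ≤ ∫⁻ x in Icc (-(n:ℝ)) n, F x ∂NNRealRMK.rieszMeasure Λ := by
            refine setLIntegral_mono' measurableSet_Icc fun x hx => ?_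
            rw [hF, hf1 hx]; simp
        _ ≤ ∫⁻ x, F x ∂NNRealRMK.rieszMeasure Λ := setLIntegral_le_lintegral _ _
        _ = Λ F := NNRealRMK.lintegral_rieszMeasure Λ F
        _ ≤ ENNReal.ofReal ‖L‖ := by
            rw [← ENNReal.ofReal_coe_nnreal, hΛ]
            refine ENNReal.ofReal_le_ofReal (absF_le _ _ (fun x => (F x).2) _ fun g hg => ?_)
            refine (L.le_opNorm g).trans (mul_le_of_le_one_right (norm_nonneg _) ?_)
            refine (BoundedContinuousFunction.norm_le zero_le_one).2 fun x => (hg x).trans ?_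
            exact (Real.coe_toNNReal _ (hf01 x).1).le.trans (hf01 x).2
    refine ⟨lt_of_le_of_lt ?_ (ENNReal.ofReal_lt_top (r := ‖L‖))⟩
    have hU : (⋃ n : ℕ, Icc (-(n:ℝ)) n) = univ := by
      refine eq_univ_of_forall fun x => mem_iUnion.2 ?_
      obtain ⟨n, hn⟩ := exists_nat_ge |x|
      exact ⟨n, abs_le.1 hn⟩
    rw [← hU, Monotone.measure_iUnion]
    · exact iSup_le hK
    · intro a b hab
      have : (a : ℝ) ≤ b := by exact_mod_cast hab
      exact Icc_subset_Icc (by linarith) this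
  · intro f hf
    let F : C_c(ℝ, ℝ≥0) := ⟨⟨fun x => ‖f x‖₊, by fun_prop⟩, hf.comp_left (g := fun z : ℂ => ‖z‖₊) (by simp)⟩
    have h1 := NNRealRMK.integral_rieszMeasure Λ F
    have : ∀ x, (F x : ℝ) = ‖f x‖ := fun x => rfl
    simp only [this] at h1
    rw [h1, hΛ]
    exact le_absF L _ ‖f‖ (fun x => f.norm_coe_le_norm x) f (fun x => le_rfl)

open BoundedContinuousFunction in
lemma riesz_dom (V : Submodule ℂ (ℝ →ᵇ ℂ)) (hV : ∀ f ∈ V, HasCompactSupport f) (Λ : V →ₗ[ℂ] ℂ)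
    (c : ℝ) (h : ∀ f, ‖Λ f‖ ≤ c * ‖f‖) :
    ∃ μ : Measure ℝ, IsFiniteMeasure μ ∧ ∀ f : V, ‖Λ f‖ ≤ ∫ x, ‖(f : ℝ →ᵇ ℂ) x‖ ∂μ := by
  obtain ⟨L, hL, -⟩ := exists_extension_norm_eq V (Λ.mkContinuous c h)
  obtain ⟨μ, hμ, H⟩ := riesz_dom_aux L
  refine ⟨μ, hμ, fun f => ?_⟩
  have := H f (hV f f.2)
  rwa [hL] at this

open BoundedContinuousFunction in
lemma riesz_repr (V : Submodule ℂ (ℝ →ᵇ ℂ)) (Λ : V →ₗ[ℂ] ℂ)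
    (μ : Measure ℝ) [IsFiniteMeasure μ] (h : ∀ f : V, ‖Λ f‖ ≤ ∫ x, ‖(f : ℝ →ᵇ ℂ) x‖ ∂μ) :
    ∃ g : ℝ → ℂ, Integrable g μ ∧ ∀ f : V, Λ f = ∫ x, (f : ℝ →ᵇ ℂ) x * g x ∂μ := by
  have hmem : ∀ f : ℝ →ᵇ ℂ, MemLp f 2 μ := fun f =>
    MemLp.of_bound f.continuous.aestronglyMeasurable ‖f‖ (ae_of_all _ f.norm_coe_le_norm)
  let j : V →ₗ[ℂ] Lp ℂ 2 μ :=
    { toFun := fun f => (hmem f).toLp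
      map_add' := fun f g => rfl
      map_smul' := fun c f => rfl }
  have hj : ∀ f : V, ‖Λ f‖ ≤ ((μ univ) ^ (1/2 : ℝ)).toReal * ‖j f‖ := by
    intro f
    refine (h f).trans ?_
    have hF := (hmem f)
    have h1 : MemLp (f : ℝ →ᵇ ℂ) 1 μ := hF.mono_exponent (by norm_num)
    have h2 := eLpNorm_le_eLpNorm_mul_rpow_measure_univ (p := 1) (q := 2) (μ := μ)
      (by norm_num) hF.1
    rw [integral_norm_eq_lintegral_enorm hF.1, ← eLpNorm_one_eq_lintegral_enorm]
    have h3 : ‖j f‖ = (eLpNorm (f : ℝ →ᵇ ℂ) 2 μ).toReal := Lp.norm_toLp _ hF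
    rw [h3, mul_comm, ← ENNReal.toReal_mul]
    refine ENNReal.toReal_mono (ENNReal.mul_ne_top hF.2.ne ?_) ?_
    · exact ENNReal.rpow_ne_top_of_nonneg (by norm_num) (measure_ne_top _ _)
    · refine h2.trans_eq ?_
      congr 2
      norm_num
  obtain ⟨s, hs⟩ := j.rangeRestrict.exists_rightInverse_of_surjective (LinearMap.range_rangeRestrict j)
  have hs' : ∀ v : LinearMap.range j, j (s v) = v := fun v => by
    have := LinearMap.congr_fun hs v
    exact congrArg Subtype.val this
  obtain ⟨L, hL, -⟩ := exists_extension_norm_eq (LinearMap.range j)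
    ((Λ.comp s).mkContinuous ((μ univ) ^ (1/2 : ℝ)).toReal (fun v => by
      have := hj (s v)
      rw [hs'] at this
      exact this))
  have hL' : ∀ f : V, L (j f) = Λ f := by
    intro f
    have e := hL ⟨j f, f, rfl⟩
    rw [e]
    have h1 := hj (s ⟨j f, f, rfl⟩ - f)
    rw [map_sub, map_sub, hs', sub_self, norm_zero, mul_zero] at h1
    exact sub_eq_zero.1 (norm_le_zero_iff.1 h1)
  let g := (InnerProductSpace.toDual ℂ (Lp ℂ 2 μ)).symm L
  refine ⟨fun x => starRingEnd ℂ (g x), ?_, fun f => ?_⟩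
  · have : Integrable g μ := (Lp.memLp g).integrable (by norm_num)
    have := (Complex.conjCLE : ℂ →L[ℝ] ℂ).integrable_comp this
    exact this
  · rw [← hL', ← InnerProductSpace.toDual_symm_apply (𝕜 := ℂ) (y := L), L2.inner_def]
    refine integral_congr_ae ?_
    filter_upwards [(hmem f).coeFn_toLp] with x hx
    change inner ℂ (g x) (((hmem f).toLp : Lp ℂ 2 μ) x) = _
    rw [hx]
    simp [mul_comm]

open BoundedContinuousFunction in
lemma riesz_vec {E : Type*} [NormedAddCommGroup E] [NormedSpace ℂ E] [FiniteDimensional ℂ E]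
    (V : Submodule ℂ (ℝ →ᵇ ℂ)) (hV : ∀ f ∈ V, HasCompactSupport f) (Λ : V →ₗ[ℂ] E)
    (c : ℝ) (h : ∀ f, ‖Λ f‖ ≤ c * ‖f‖) :
    ∃ (μ : Measure ℝ) (g : ℝ → E), IsFiniteMeasure μ ∧ Integrable g μ ∧
      ∀ f : V, Λ f = ∫ x, (f : ℝ →ᵇ ℂ) x • g x ∂μ := by
  let b := Module.finBasis ℂ E
  let co : ∀ i, E →L[ℂ] ℂ := fun i => LinearMap.toContinuousLinearMap (b.coord i)
  have hco : ∀ i e, co i e = b.repr e i := fun i e => rfl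
  have h1 : ∀ i, ∃ μ : Measure ℝ, IsFiniteMeasure μ ∧
      ∀ f : V, ‖(co i).toLinearMap.comp Λ f‖ ≤ ∫ x, ‖(f : ℝ →ᵇ ℂ) x‖ ∂μ := fun i =>
    riesz_dom V hV _ (‖co i‖ * c) fun f => by
      refine ((co i).le_opNorm _).trans ?_
      rw [mul_assoc]
      gcongr
      exact h f
  choose μ hμ H using h1
  let ν := Measure.sum μ
  have hν : IsFiniteMeasure ν := by
    constructor
    simp only [ν, Measure.sum_apply _ MeasurableSet.univ, tsum_fintype]
    exact ENNReal.sum_lt_top.2 fun i _ => measure_lt_top _ _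
  have h2 : ∀ i, ∃ g : ℝ → ℂ, Integrable g ν ∧
      ∀ f : V, (co i).toLinearMap.comp Λ f = ∫ x, (f : ℝ →ᵇ ℂ) x * g x ∂ν := by
    intro i
    refine riesz_repr V _ ν fun f => (H i f).trans ?_
    refine integral_mono_measure (Measure.le_sum μ i) (ae_of_all _ fun x => norm_nonneg _) ?_
    exact ((f : ℝ →ᵇ ℂ).integrable ν).norm
  choose g hg Hg using h2
  refine ⟨ν, fun x => ∑ i, g i x • b i, hν, ?_, fun f => ?_⟩
  · exact integrable_finsetSum _ fun i _ => (hg i).smul_const _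
  · simp only [Finset.smul_sum, smul_smul]
    rw [integral_finsetSum]
    · simp only [integral_smul_const]
      conv_lhs => rw [← b.sum_repr (Λ f)]
      refine Finset.sum_congr rfl fun i _ => ?_
      rw [← Hg i f]
      rfl
    · intro i _
      refine Integrable.smul_const ?_ _
      exact (hg i).bdd_mul (f : ℝ →ᵇ ℂ).continuous.aestronglyMeasurable
        (ae_of_all _ fun x => (f : ℝ →ᵇ ℂ).norm_coe_le_norm x)


lemma C0Semigroup.locbdd {X : Type*} [NormedAddCommGroup X] [NormedSpace ℂ X] [CompleteSpace X]
    (S : C0Semigroup X) (t : ℝ) : ∃ K, ∀ s ∈ Icc 0 t, ‖S.T s‖ ≤ K := by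
  obtain ⟨K, hK⟩ := banach_steinhaus (g := fun s : Icc (0:ℝ) t => S.T s) (fun x => by
    obtain ⟨C, hC⟩ := (isCompact_Icc (a := (0:ℝ)) (b := t)).exists_bound_of_continuousOn
      ((S.strongly_continuous x).mono Icc_subset_Ici_self)
    exact ⟨C, fun s => hC s s.2⟩)
  exact ⟨K, fun s hs => hK ⟨s, hs⟩⟩

namespace SystemNode

variable {U X Xm1 Y : Type*}
  [NormedAddCommGroup U] [NormedSpace ℂ U]
  [NormedAddCommGroup X] [NormedSpace ℂ X]
  [NormedAddCommGroup Xm1] [NormedSpace ℂ Xm1]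
  [NormedAddCommGroup Y] [NormedSpace ℂ Y]

lemma uniq [CompleteSpace Xm1] (sys : SystemNode U X Xm1 Y) (ξ ξ' : ℝ → X) (T : ℝ) (hT : 0 ≤ T)
    (hc : ContinuousOn ξ (Icc 0 T)) (hd : ∀ t ∈ Ico 0 T, HasDerivWithinAt ξ (ξ' t) (Ici t) t)
    (hA : ∀ t ∈ Ico 0 T, sys.Am1 (ξ t) = sys.ι (ξ' t)) (h0 : ξ 0 = 0) : ξ T = 0 := by
  obtain ⟨K, hK⟩ := sys.Sm1.locbdd T
  have hK' : ∀ s ∈ Icc 0 T, ‖sys.Sm1.T (T - s)‖ ≤ K := fun s hs =>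
    hK _ ⟨by linarith [hs.2], by linarith [hs.1]⟩
  have key : ∀ s ∈ Icc 0 T, sys.Sm1.T (T - s) (sys.ι (ξ s)) = sys.Sm1.T (T - 0) (sys.ι (ξ 0)) := by
    refine constant_of_has_deriv_right_zero (f := fun s => sys.Sm1.T (T - s) (sys.ι (ξ s))) ?_ ?_
    · intro s hs
      have h1 : Filter.Tendsto (fun s' => sys.Sm1.T (T - s') (sys.ι (ξ s)))
          (𝓝[Icc 0 T] s) (𝓝 (sys.Sm1.T (T - s) (sys.ι (ξ s)))) := by
        have : ContinuousOn (fun s' => sys.Sm1.T (T - s') (sys.ι (ξ s))) (Icc 0 T) :=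
          (sys.Sm1.strongly_continuous (sys.ι (ξ s))).comp (f := fun s' => T - s')
            (by fun_prop) (fun r hr => by simpa using hr.2)
        exact this s hs
      have h2 : Filter.Tendsto (fun s' => sys.Sm1.T (T - s') (sys.ι (ξ s') - sys.ι (ξ s)))
          (𝓝[Icc 0 T] s) (𝓝 0) := by
        have h3 : Filter.Tendsto (fun s' => K * ‖sys.ι (ξ s') - sys.ι (ξ s)‖)
          (𝓝[Icc 0 T] s) (𝓝 (K * ‖sys.ι (ξ s) - sys.ι (ξ s)‖)) := by
          have : ContinuousOn (fun s' => K * ‖sys.ι (ξ s') - sys.ι (ξ s)‖) (Icc 0 T) := by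
            fun_prop
          exact this s hs
        rw [sub_self, norm_zero, mul_zero] at h3
        refine squeeze_zero_norm' ?_ h3
        filter_upwards [self_mem_nhdsWithin] with r hr
        exact ((sys.Sm1.T (T - r)).le_opNorm _).trans (by gcongr; exact hK' r hr)
      have := h1.add h2
      simp only [map_sub, add_sub_cancel, add_zero] at this
      exact this
    · intro s hs
      have hp : HasDerivWithinAt (fun r => sys.ι (ξ r) - sys.ι (sys.S.T (r - s) (ξ s)))
          (sys.ι (ξ' s) - sys.Am1 (ξ s)) (Ici s) s := by
        refine HasDerivWithinAt.sub ?_ ?_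
        · have := (sys.ι.restrictScalars ℝ).hasFDerivAt.comp_hasDerivWithinAt s (hd s hs)
          exact this
        · have h1 := sys.generator (ξ s) 0 le_rfl
          rw [sys.S.map_zero] at h1
          have h2 : HasDerivWithinAt (fun r : ℝ => r - s) 1 (Ici s) s :=
            (hasDerivWithinAt_id s _).sub_const s
          have h3 := HasDerivWithinAt.scomp_of_eq (t' := Ici 0) s h1 h2
            (fun r hr => by simpa using hr) (by simp)
          rw [ContinuousLinearMap.id_apply, one_smul] at h3
          exact h3
      rw [hA s hs, sub_self] at hp
      rw [hasDerivWithinAt_iff_isLittleO] at hp ⊢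
      simp only [sub_self, smul_zero, sub_zero, sys.S.map_zero, ContinuousLinearMap.id_apply] at hp ⊢
      refine Asymptotics.IsBigO.trans_isLittleO ?_ hp
      refine Asymptotics.IsBigO.of_bound K ?_
      have : Ioo (s - 1) T ∈ 𝓝 s := Ioo_mem_nhds (by linarith) hs.2
      filter_upwards [self_mem_nhdsWithin, mem_nhdsWithin_of_mem_nhds this] with r hr hr2
      have hsr : s ≤ r := hr
      have e : sys.Sm1.T (T - s) (sys.ι (ξ s))
          = sys.Sm1.T (T - r) (sys.ι (sys.S.T (r - s) (ξ s))) := by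
        have h1 := sys.Sm1.map_add (T - r) (r - s) (by linarith [hr2.2]) (by linarith)
        rw [sub_add_sub_cancel] at h1
        rw [← sys.semigroup_compat _ (by linarith), h1, ContinuousLinearMap.comp_apply]
      rw [e, ← map_sub]
      exact ((sys.Sm1.T (T - r)).le_opNorm _).trans
        (by gcongr; exact hK' r ⟨hs.1.trans hsr, hr2.2.le⟩)
  have := key T ⟨hT, le_rfl⟩
  rw [h0, sub_self, sys.Sm1.map_zero] at this
  simp only [ContinuousLinearMap.id_apply, map_zero] at this
  exact sys.ι_injective (by simpa using this)

lemma beta_re (sys : SystemNode U X Xm1 Y) : sys.S.growthBound < sys.betaPt.re := by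
  simp [betaPt]

/-- resolvent composed with the control operator. -/
noncomputable def bb (sys : SystemNode U X Xm1 Y) : U →L[ℂ] X := (sys.R sys.betaPt).comp sys.B

lemma Am1_bb (sys : SystemNode U X Xm1 Y) (u : U) :
    sys.Am1 (sys.bb u) = sys.betaPt • sys.ι (sys.bb u) - sys.B u := by
  have := sys.R_right _ sys.beta_re (sys.B u)
  change _ - sys.Am1 (sys.bb u) = _ at this
  rw [← this]
  simp [bb]

lemma dom_sub_bb (sys : SystemNode U X Xm1 Y) {x z : X} {u : U}
    (h : sys.Am1 x + sys.B u = sys.ι z) :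
    sys.Am1 (x - sys.bb u) = sys.ι (z - sys.betaPt • sys.bb u) := by
  rw [map_sub, Am1_bb, map_sub, ← h, map_smul]
  abel

lemma CD_add (sys : SystemNode U X Xm1 Y) {x₁ z₁ x₂ z₂ : X} {u₁ u₂ : U}
    (h₁ : sys.Am1 x₁ + sys.B u₁ = sys.ι z₁) (h₂ : sys.Am1 x₂ + sys.B u₂ = sys.ι z₂) :
    sys.CD (x₁ + x₂) (u₁ + u₂) = sys.CD x₁ u₁ + sys.CD x₂ u₂ := by
  have := sys.Cop_add _ _ ⟨_, sys.dom_sub_bb h₁⟩ ⟨_, sys.dom_sub_bb h₂⟩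
  have e : x₁ + x₂ - sys.R sys.betaPt (sys.B (u₁ + u₂)) = (x₁ - sys.bb u₁) + (x₂ - sys.bb u₂) := by
    simp only [bb, map_add, ContinuousLinearMap.comp_apply]
    abel
  simp only [CD]
  rw [e, this, map_add]
  simp only [bb, ContinuousLinearMap.comp_apply]
  abel

lemma CD_smul (sys : SystemNode U X Xm1 Y) (a : ℂ) {x₁ z₁ : X} {u₁ : U}
    (h₁ : sys.Am1 x₁ + sys.B u₁ = sys.ι z₁) :
    sys.CD (a • x₁) (a • u₁) = a • sys.CD x₁ u₁ := by
  have := sys.Cop_smul a _ ⟨_, sys.dom_sub_bb h₁⟩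
  have e : a • x₁ - sys.R sys.betaPt (sys.B (a • u₁)) = a • (x₁ - sys.bb u₁) := by
    simp only [bb, map_smul, ContinuousLinearMap.comp_apply, smul_sub]
  simp only [CD]
  rw [e, this, map_smul]
  simp only [bb, ContinuousLinearMap.comp_apply, smul_add]

lemma CD_sub (sys : SystemNode U X Xm1 Y) {x₁ z₁ x₂ z₂ : X} {u₁ u₂ : U}
    (h₁ : sys.Am1 x₁ + sys.B u₁ = sys.ι z₁) (h₂ : sys.Am1 x₂ + sys.B u₂ = sys.ι z₂) :
    sys.CD (x₁ - x₂) (u₁ - u₂) = sys.CD x₁ u₁ - sys.CD x₂ u₂ := by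
  have h3 : sys.Am1 ((-1 : ℂ) • x₂) + sys.B ((-1 : ℂ) • u₂) = sys.ι ((-1 : ℂ) • z₂) := by
    rw [map_smul, map_smul, map_smul, ← h₂, smul_add]
  have := sys.CD_add h₁ h3
  rw [sys.CD_smul _ h₂] at this
  simpa [sub_eq_add_neg] using this

lemma CD_bound (sys : SystemNode U X Xm1 Y) : ∃ K : ℝ, ∀ (x z : X) (u : U),
    sys.Am1 x + sys.B u = sys.ι z → ‖sys.CD x u‖ ≤ K * (‖x‖ + ‖u‖ + ‖z‖) := by
  obtain ⟨M, hM⟩ := sys.Cop_bound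
  refine ⟨|M| * (1 + ‖sys.bb‖ + ‖sys.betaPt‖ * ‖sys.bb‖) + ‖sys.G sys.betaPt‖, fun x z u h => ?_⟩
  have h1 := hM _ _ (sys.dom_sub_bb h)
  have h2 : ‖sys.CD x u‖ ≤ ‖sys.Cop (x - sys.bb u)‖ + ‖sys.G sys.betaPt u‖ := norm_add_le _ _
  have h3 : ‖sys.bb u‖ ≤ ‖sys.bb‖ * ‖u‖ := sys.bb.le_opNorm u
  have h4 : ‖sys.G sys.betaPt u‖ ≤ ‖sys.G sys.betaPt‖ * ‖u‖ := (sys.G sys.betaPt).le_opNorm u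
  have h5 : ‖x - sys.bb u‖ ≤ ‖x‖ + ‖sys.bb‖ * ‖u‖ := (norm_sub_le _ _).trans (by gcongr)
  have h6 : ‖z - sys.betaPt • sys.bb u‖ ≤ ‖z‖ + ‖sys.betaPt‖ * (‖sys.bb‖ * ‖u‖) :=
    (norm_sub_le _ _).trans (by rw [norm_smul]; gcongr)
  have h7 : ‖sys.Cop (x - sys.bb u)‖ ≤
      |M| * ((‖x‖ + ‖sys.bb‖ * ‖u‖) + (‖z‖ + ‖sys.betaPt‖ * (‖sys.bb‖ * ‖u‖))) :=
    h1.trans (mul_le_mul (le_abs_self _) (add_le_add h5 h6) (by positivity) (abs_nonneg _))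
  refine h2.trans ((add_le_add h7 h4).trans ?_)
  have e : (|M| * (1 + ‖sys.bb‖ + ‖sys.betaPt‖ * ‖sys.bb‖) + ‖sys.G sys.betaPt‖)
      * (‖x‖ + ‖u‖ + ‖z‖) - (|M| * ((‖x‖ + ‖sys.bb‖ * ‖u‖) + (‖z‖ + ‖sys.betaPt‖ *
      (‖sys.bb‖ * ‖u‖))) + ‖sys.G sys.betaPt‖ * ‖u‖) =
      |M| * ‖u‖ + |M| * (‖sys.bb‖ + ‖sys.betaPt‖ * ‖sys.bb‖) * (‖x‖ + ‖z‖)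
        + ‖sys.G sys.betaPt‖ * (‖x‖ + ‖z‖) := by ring
  have : 0 ≤ |M| * ‖u‖ + |M| * (‖sys.bb‖ + ‖sys.betaPt‖ * ‖sys.bb‖) * (‖x‖ + ‖z‖)
        + ‖sys.G sys.betaPt‖ * (‖x‖ + ‖z‖) := by positivity
  linarith

/-- if the arguments converge in the graph norm, so do the outputs. -/
lemma CD_tendsto (sys : SystemNode U X Xm1 Y) {α : Type*} {l : Filter α} {x z : α → X} {u : α → U}
    {x₀ z₀ : X} {u₀ : U} (h : ∀ᶠ a in l, sys.Am1 (x a) + sys.B (u a) = sys.ι (z a))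
    (h₀ : sys.Am1 x₀ + sys.B u₀ = sys.ι z₀) (hx : Filter.Tendsto x l (𝓝 x₀))
    (hz : Filter.Tendsto z l (𝓝 z₀)) (hu : Filter.Tendsto u l (𝓝 u₀)) :
    Filter.Tendsto (fun a => sys.CD (x a) (u a)) l (𝓝 (sys.CD x₀ u₀)) := by
  obtain ⟨K, hK⟩ := sys.CD_bound
  rw [tendsto_iff_norm_sub_tendsto_zero]
  have h1 : Filter.Tendsto (fun a => K * (‖x a - x₀‖ + ‖u a - u₀‖ + ‖z a - z₀‖)) l (𝓝 0) := by
    have := (((tendsto_iff_norm_sub_tendsto_zero.1 hx).add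
      (tendsto_iff_norm_sub_tendsto_zero.1 hu)).add
      (tendsto_iff_norm_sub_tendsto_zero.1 hz)).const_mul K
    simpa using this
  refine squeeze_zero' (Filter.Eventually.of_forall fun a => norm_nonneg _) ?_ h1
  filter_upwards [h] with a ha
  rw [← sys.CD_sub ha h₀]
  refine hK _ _ _ ?_
  rw [map_sub, map_sub, map_sub, ← ha, ← h₀]
  abel

end SystemNode


lemma hasDerivAt_clm_of_apply {U Z : Type*} [NormedAddCommGroup U] [NormedSpace ℂ U]
    [FiniteDimensional ℂ U] [NormedAddCommGroup Z] [NormedSpace ℂ Z]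
    (P : ℝ → U →L[ℂ] Z) (P' : U →L[ℂ] Z) (s : ℝ)
    (h : ∀ e, HasDerivAt (fun s => P s e) (P' e) s) : HasDerivAt P P' s := by
  let b := Module.finBasis ℂ U
  let co : ∀ i, U →L[ℂ] ℂ := fun i => LinearMap.toContinuousLinearMap (b.coord i)
  have e : ∀ Q : U →L[ℂ] Z, Q = ∑ i, ContinuousLinearMap.smulRightL ℂ U Z (co i) (Q (b i)) := by
    intro Q
    ext u
    conv_lhs => rw [← b.sum_repr u]
    simp only [map_sum, map_smul, ContinuousLinearMap.sum_apply,
      ContinuousLinearMap.smulRightL_apply_apply]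
    rfl
  have h1 : P = fun s => ∑ i, ContinuousLinearMap.smulRightL ℂ U Z (co i) (P s (b i)) :=
    funext fun s => e (P s)
  rw [h1, e P']
  refine HasDerivAt.fun_sum fun i _ => ?_
  exact ((ContinuousLinearMap.smulRightL ℂ U Z (co i)).restrictScalars ℝ).hasFDerivAt.comp_hasDerivAt
    s (h (b i))

lemma exists_radius {U : Type*} [NormedAddCommGroup U] {v : ℝ → U} (hv : HasCompactSupport v) :
    ∃ R : ℝ, 0 < R ∧ tsupport v ⊆ Ioo (-R) R := by
  obtain ⟨R, hR⟩ := hv.isCompact.isBounded.subset_ball 0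
  refine ⟨max R 1, by positivity, fun s hs => ?_⟩
  have := hR hs
  rw [mem_ball_zero_iff, Real.norm_eq_abs, abs_lt] at this
  exact ⟨by linarith [le_max_left R 1], this.2.trans_le (le_max_left _ _)⟩

namespace SystemNode

variable {U X Xm1 Y : Type*}
  [NormedAddCommGroup U] [NormedSpace ℂ U] [FiniteDimensional ℂ U]
  [NormedAddCommGroup X] [NormedSpace ℂ X]
  [NormedAddCommGroup Xm1] [NormedSpace ℂ Xm1]
  [NormedAddCommGroup Y] [NormedSpace ℂ Y]

/-- the input-to-state kernel. -/
noncomputable def kk (sys : SystemNode U X Xm1 Y) : ℝ → U →L[ℂ] X :=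
  (Ici (0:ℝ)).indicator (fun s => (sys.S.T s).comp sys.bb)

lemma kk_locInt (sys : SystemNode U X Xm1 Y) : LocallyIntegrable sys.kk volume := by
  rw [locallyIntegrable_iff]
  intro K hK
  refine (integrableOn_indicator_iff (μ := volume) (t := K) (s := Ici (0:ℝ))
    (f := fun s => (sys.S.T s).comp sys.bb) measurableSet_Ici).2 ?_
  refine ContinuousOn.integrableOn_compact (hK.inter_left isClosed_Ici) ?_
  refine ContinuousOn.mono ?_ inter_subset_left
  rw [continuousOn_clm_apply]
  exact fun y => sys.S.strongly_continuous (sys.bb y)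

/-- the bilinear evaluation map. -/
noncomputable def evL (U X : Type*) [NormedAddCommGroup U] [NormedSpace ℂ U]
    [NormedAddCommGroup X] [NormedSpace ℂ X] : (U →L[ℂ] X) →L[ℝ] U →L[ℝ] X :=
  ContinuousLinearMap.restrictScalarsL ℂ U X ℝ ℝ

/-- the state response of the kernel. -/
noncomputable def ww (sys : SystemNode U X Xm1 Y) (v : ℝ → U) (t : ℝ) : X :=
  ∫ s, sys.kk s (v (t - s))

lemma ww_eq (sys : SystemNode U X Xm1 Y) (v : ℝ → U) :
    sys.ww v = convolution sys.kk v (evL U X) volume := rfl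

lemma ww_int (sys : SystemNode U X Xm1 Y) {v : ℝ → U} (hv : Continuous v)
    (hc : HasCompactSupport v) (t : ℝ) : Integrable (fun s => sys.kk s (v (t - s))) :=
  hc.convolutionExists_right (evL U X) sys.kk_locInt hv t

lemma ww_cont (sys : SystemNode U X Xm1 Y) {v : ℝ → U} (hv : Continuous v)
    (hc : HasCompactSupport v) : Continuous (sys.ww v) :=
  hc.continuous_convolution_right (evL U X) sys.kk_locInt hv

lemma ww_deriv (sys : SystemNode U X Xm1 Y) {v : ℝ → U} (hv : ContDiff ℝ 1 v)
    (hc : HasCompactSupport v) (t : ℝ) : HasDerivAt (sys.ww v) (sys.ww (deriv v) t) t :=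
  hc.hasDerivAt_convolution_right (evL U X) sys.kk_locInt hv t

lemma ww_shift (sys : SystemNode U X Xm1 Y) (v : ℝ → U) (a t : ℝ) :
    sys.ww (fun s => v (s + a)) t = sys.ww v (t + a) := by
  simp only [ww]
  congr 1
  ext s
  congr 2
  ring

lemma ww_zero (sys : SystemNode U X Xm1 Y) (v : ℝ → U) (t : ℝ) (h : ∀ s ≤ t, v s = 0) :
    sys.ww v t = 0 := by
  refine integral_eq_zero_of_ae (ae_of_all _ fun s => ?_)
  by_cases hs : s ∈ Ici (0:ℝ)
  · simp [h (t - s) (by simpa using hs)]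
  · simp [kk, hs]

lemma ww_add (sys : SystemNode U X Xm1 Y) {v w : ℝ → U} (hv : Continuous v)
    (hc : HasCompactSupport v) (hw : Continuous w) (hcw : HasCompactSupport w) (t : ℝ) :
    sys.ww (fun s => v s + w s) t = sys.ww v t + sys.ww w t := by
  simp only [ww, map_add]
  exact integral_add (sys.ww_int hv hc t) (sys.ww_int hw hcw t)

lemma ww_smul (sys : SystemNode U X Xm1 Y) (a : ℂ) (v : ℝ → U) (t : ℝ) :
    sys.ww (fun s => a • v s) t = a • sys.ww v t := by
  simp only [ww, map_smul]
  exact integral_smul _ _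

lemma Am1_ww [CompleteSpace X] [CompleteSpace Xm1] (sys : SystemNode U X Xm1 Y) {v : ℝ → U}
    (hv : ContDiff ℝ 1 v) (hc : HasCompactSupport v) (t : ℝ) :
    sys.Am1 (sys.ww v t) = sys.ι (sys.ww (deriv v) t - sys.bb (v t)) := by
  have i1 := sys.ww_int hv.continuous hc t
  have i2 := sys.ww_int (hv.continuous_deriv le_rfl) hc.deriv t
  have j1 := sys.Am1.integrable_comp i1
  have j2 := sys.ι.integrable_comp i2
  have e1 : sys.Am1 (sys.ww v t) = ∫ s, sys.Am1 (sys.kk s (v (t - s))) :=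
    (sys.Am1.integral_comp_comm i1).symm
  have e2 : sys.ι (sys.ww (deriv v) t) = ∫ s, sys.ι (sys.kk s (deriv v (t - s))) :=
    (sys.ι.integral_comp_comm i2).symm
  suffices h : (∫ s, (sys.Am1 (sys.kk s (v (t - s))) - sys.ι (sys.kk s (deriv v (t - s)))))
      = 0 - sys.ι (sys.bb (v t)) by
    rw [integral_sub j1 j2, ← e1, ← e2] at h
    rw [sub_eq_iff_eq_add] at h
    rw [map_sub, h]
    abel
  have hz : ∀ s ∉ Ici (0:ℝ),
      sys.Am1 (sys.kk s (v (t - s))) - sys.ι (sys.kk s (deriv v (t - s))) = 0 := by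
    intro s hs
    simp [kk, hs]
  rw [← setIntegral_eq_integral_of_forall_compl_eq_zero hz, integral_Ici_eq_integral_Ioi]
  have hTc : ContinuousOn (fun s => sys.ι (sys.S.T s (sys.bb (v (t - s))))) (Ici 0) := by
    have h1 : ContinuousOn (fun s => (sys.S.T s).comp sys.bb) (Ici 0) := by
      rw [continuousOn_clm_apply]
      exact fun y => sys.S.strongly_continuous (sys.bb y)
    have h2 : Continuous (fun s => v (t - s)) := hv.continuous.comp (by fun_prop)
    have h3 := h1.clm_apply h2.continuousOn
    exact sys.ι.continuous.comp_continuousOn h3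
  have main := integral_Ioi_of_hasDerivAt_of_tendsto (a := 0) (m := 0)
    (f := fun s => sys.ι (sys.S.T s (sys.bb (v (t - s)))))
    (f' := fun s => sys.Am1 (sys.kk s (v (t - s))) - sys.ι (sys.kk s (deriv v (t - s))))
    (hTc 0 self_mem_Ici) ?_ (j1.sub j2).integrableOn ?_
  · rw [main]
    simp [sys.S.map_zero]
  · intro s hs
    have hs0 : (0:ℝ) < s := hs
    have k : sys.kk s = (sys.S.T s).comp sys.bb := by simp [kk, hs0.le]
    have hP : HasDerivAt (fun s => sys.ι.comp ((sys.S.T s).comp sys.bb))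
        (sys.Am1.comp ((sys.S.T s).comp sys.bb)) s := by
      refine hasDerivAt_clm_of_apply _ _ _ fun e => ?_
      exact (sys.generator (sys.bb e) s hs0.le).hasDerivAt (Ici_mem_nhds hs0)
    have hP' := (evL U Xm1).hasFDerivAt.comp_hasDerivAt s hP
    have hv' : HasDerivAt (fun s => v (t - s)) (-deriv v (t - s)) s := by
      have h1 : HasDerivAt v (deriv v (t - s)) (t - s) :=
        (hv.differentiable one_ne_zero _).hasDerivAt
      have h2 : HasDerivAt (fun s : ℝ => t - s) (-1) s := by
        simpa using (hasDerivAt_id s).const_sub t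
      have h3 := h1.scomp s h2
      rw [neg_smul, one_smul] at h3
      exact h3
    have h4 := hP'.clm_apply hv'
    have h5 : sys.Am1 (sys.kk s (v (t - s))) - sys.ι (sys.kk s (deriv v (t - s))) =
      (evL U Xm1 (sys.Am1.comp ((sys.S.T s).comp sys.bb))) (v (t - s)) +
      (evL U Xm1 (sys.ι.comp ((sys.S.T s).comp sys.bb))) (-deriv v (t - s)) := by
      rw [map_neg, k, sub_eq_add_neg]
      rfl
    rw [h5]
    exact h4
  · obtain ⟨R, hR, hR'⟩ := exists_radius hc
    refine tendsto_const_nhds.congr' ?_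
    filter_upwards [Filter.eventually_ge_atTop (t + R)] with s hs
    have : v (t - s) = 0 := by
      by_contra hne
      have := (hR' (subset_tsupport v hne)).1
      linarith
    simp [this]

/-- the forcing term. -/
noncomputable def psi (sys : SystemNode U X Xm1 Y) (u : ℝ → U) (s : ℝ) : U :=
  sys.betaPt • u s - deriv u s

/-- the explicit state. -/
noncomputable def XX (sys : SystemNode U X Xm1 Y) (u : ℝ → U) (t : ℝ) : X :=
  sys.bb (u t) + sys.ww (sys.psi u) t

/-- the explicit derivative of the state. -/
noncomputable def XX' (sys : SystemNode U X Xm1 Y) (u : ℝ → U) (t : ℝ) : X :=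
  sys.bb (deriv u t) + sys.ww (deriv (sys.psi u)) t

lemma psi_smooth (sys : SystemNode U X Xm1 Y) {u : ℝ → U} (hu : ContDiff ℝ (⊤ : ℕ∞) u) :
    ContDiff ℝ 1 (sys.psi u) := by
  have h1 : ContDiff ℝ 1 u := hu.of_le (by exact_mod_cast le_top)
  have h2 : ContDiff ℝ 1 (deriv u) := by
    have : ContDiff ℝ (1 + 1) u :=
      hu.of_le (WithTop.coe_le_coe.2 (le_top : (1 + 1 : ℕ∞) ≤ ⊤))
    exact (contDiff_succ_iff_deriv.1 this).2.2
  exact (h1.const_smul sys.betaPt).sub h2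

lemma psi_supp (sys : SystemNode U X Xm1 Y) {u : ℝ → U} (hc : HasCompactSupport u) :
    HasCompactSupport (sys.psi u) :=
  (hc.smul_left (f := fun _ => sys.betaPt)).sub hc.deriv

lemma XX_hasDerivAt (sys : SystemNode U X Xm1 Y) {u : ℝ → U} (hu : ContDiff ℝ (⊤ : ℕ∞) u)
    (hc : HasCompactSupport u) (t : ℝ) : HasDerivAt (sys.XX u) (sys.XX' u t) t := by
  have h1 : HasDerivAt u (deriv u t) t := (hu.differentiable (by simp) t).hasDerivAt
  have h2 := (sys.bb.restrictScalars ℝ).hasFDerivAt.comp_hasDerivAt t h1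
  exact h2.add (sys.ww_deriv (sys.psi_smooth hu) (sys.psi_supp hc) t)

lemma XX'_cont (sys : SystemNode U X Xm1 Y) {u : ℝ → U} (hu : ContDiff ℝ (⊤ : ℕ∞) u)
    (hc : HasCompactSupport u) : Continuous (sys.XX' u) := by
  have h1 : Continuous (deriv u) := hu.continuous_deriv (by simp)
  exact (sys.bb.continuous.comp h1).add
    (sys.ww_cont ((sys.psi_smooth hu).continuous_deriv le_rfl) (sys.psi_supp hc).deriv)

lemma XX_dom [CompleteSpace X] [CompleteSpace Xm1] (sys : SystemNode U X Xm1 Y) {u : ℝ → U}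
    (hu : ContDiff ℝ (⊤ : ℕ∞) u) (hc : HasCompactSupport u) (t : ℝ) :
    sys.Am1 (sys.XX u t) + sys.B (u t) = sys.ι (sys.XX' u t) := by
  rw [XX, XX', map_add, Am1_bb, sys.Am1_ww (sys.psi_smooth hu) (sys.psi_supp hc)]
  simp only [psi, map_sub, map_smul, map_add]
  abel

lemma XX_zero (sys : SystemNode U X Xm1 Y) (u : ℝ → U) (t : ℝ) (h : ∀ s ≤ t, u s = 0)
    (h' : ∀ s ≤ t, deriv u s = 0) : sys.XX u t = 0 := by
  rw [XX, h t le_rfl, map_zero, zero_add]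
  exact sys.ww_zero _ _ fun s hs => by simp [psi, h s hs, h' s hs]

lemma XX_shift (sys : SystemNode U X Xm1 Y) (u : ℝ → U) (a t : ℝ) :
    sys.XX (fun s => u (s + a)) t = sys.XX u (t + a) := by
  rw [XX, XX, ← ww_shift]
  congr 2
  ext s
  simp only [psi, deriv_comp_add_const]

lemma XX_add (sys : SystemNode U X Xm1 Y) {u v : ℝ → U} (hu : ContDiff ℝ (⊤ : ℕ∞) u)
    (hc : HasCompactSupport u) (hv : ContDiff ℝ (⊤ : ℕ∞) v) (hcv : HasCompactSupport v) (t : ℝ) :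
    sys.XX (fun s => u s + v s) t = sys.XX u t + sys.XX v t := by
  have : sys.psi (fun s => u s + v s) = fun s => sys.psi u s + sys.psi v s := by
    ext s
    simp only [psi]
    rw [deriv_fun_add (hu.differentiable (by simp) s) (hv.differentiable (by simp) s), smul_add]
    abel
  rw [XX, XX, XX, this, sys.ww_add (sys.psi_smooth hu).continuous (sys.psi_supp hc)
    (sys.psi_smooth hv).continuous (sys.psi_supp hcv), map_add]
  abel

lemma XX_smul (sys : SystemNode U X Xm1 Y) (a : ℂ) {u : ℝ → U} (hu : ContDiff ℝ (⊤ : ℕ∞) u)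
    (t : ℝ) : sys.XX (fun s => a • u s) t = a • sys.XX u t := by
  have : sys.psi (fun s => a • u s) = fun s => a • sys.psi u s := by
    ext s
    simp only [psi]
    rw [deriv_fun_const_smul _ (hu.differentiable (by simp) s), smul_sub, smul_comm]
  rw [XX, XX, this, ww_smul, map_smul, smul_add]

/-- the output at time zero for a smooth compactly supported input on the line. -/
noncomputable def Th (sys : SystemNode U X Xm1 Y) (u : ℝ → U) : Y := sys.CD (sys.XX u 0) (u 0)

lemma Th_shift (sys : SystemNode U X Xm1 Y) (u : ℝ → U) (a : ℝ) :
    sys.Th (fun s => u (s + a)) = sys.CD (sys.XX u a) (u a) := by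
  rw [Th, XX_shift, zero_add]

variable [CompleteSpace X] [CompleteSpace Xm1]

lemma Th_add (sys : SystemNode U X Xm1 Y) {u v : ℝ → U} (hu : ContDiff ℝ (⊤ : ℕ∞) u)
    (hc : HasCompactSupport u) (hv : ContDiff ℝ (⊤ : ℕ∞) v) (hcv : HasCompactSupport v) :
    sys.Th (fun s => u s + v s) = sys.Th u + sys.Th v := by
  rw [Th, sys.XX_add hu hc hv hcv, sys.CD_add (sys.XX_dom hu hc 0) (sys.XX_dom hv hcv 0)]
  rfl

lemma Th_smul (sys : SystemNode U X Xm1 Y) (a : ℂ) {u : ℝ → U} (hu : ContDiff ℝ (⊤ : ℕ∞) u)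
    (hc : HasCompactSupport u) : sys.Th (fun s => a • u s) = a • sys.Th u := by
  rw [Th, sys.XX_smul a hu, sys.CD_smul a (sys.XX_dom hu hc 0)]
  rfl

lemma deriv_zero_of_supp {u : ℝ → U} {s : ℝ} (h : s ∉ tsupport u) : deriv u s = 0 := by
  by_contra hne
  exact h (support_deriv_subset hne)

lemma XX_isSol (sys : SystemNode U X Xm1 Y) {u : ℝ → U} (hu : ContDiff ℝ (⊤ : ℕ∞) u)
    (hc : HasCompactSupport u) :
    sys.IsClassicalSolution u (sys.XX u) (fun t => sys.CD (sys.XX u t) (u t)) := by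
  refine ⟨hu.continuous.continuousOn, ?_, ⟨sys.XX' u, (sys.XX'_cont hu hc).continuousOn,
    fun t _ => (sys.XX_hasDerivAt hu hc t).hasDerivWithinAt, fun t _ => sys.XX_dom hu hc t⟩,
    fun t _ => rfl⟩
  refine Continuous.continuousOn (continuous_iff_continuousAt.2 fun t => ?_)
  exact sys.CD_tendsto (Filter.Eventually.of_forall fun s => sys.XX_dom hu hc s)
    (sys.XX_dom hu hc t) (sys.XX_hasDerivAt hu hc t).continuousAt
    (sys.XX'_cont hu hc).continuousAt hu.continuous.continuousAt

lemma XX_zero' (sys : SystemNode U X Xm1 Y) {u : ℝ → U} (h : tsupport u ⊆ Ioi 0) :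
    sys.XX u 0 = 0 := by
  have h1 : ∀ s ≤ (0:ℝ), s ∉ tsupport u := fun s hs hs' => (not_lt.2 hs) (h hs')
  exact sys.XX_zero u 0 (fun s hs => image_eq_zero_of_notMem_tsupport (h1 s hs))
    (fun s hs => deriv_zero_of_supp (h1 s hs))

lemma Th_bound (sys : SystemNode U X Xm1 Y) (hb : sys.CInfBIBOStable) :
    ∃ c : ℝ, 0 < c ∧ ∀ u : ℝ → U, ContDiff ℝ (⊤ : ℕ∞) u → HasCompactSupport u →
      ∀ M : ℝ, (∀ s, ‖u s‖ ≤ M) → ‖sys.Th u‖ ≤ c * M := by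
  obtain ⟨c, hc0, H⟩ := hb
  refine ⟨c, hc0, fun u hu hc M hM => ?_⟩
  obtain ⟨R, hR, hR'⟩ := exists_radius hc
  let v : ℝ → U := fun s => u (s - R)
  have hv : ContDiff ℝ (⊤ : ℕ∞) v := hu.comp (contDiff_id.sub contDiff_const)
  have hcv : HasCompactSupport v := hc.comp_homeomorph (Homeomorph.subRight R)
  have hsv : tsupport v ⊆ Ioi 0 := by
    have : tsupport v ⊆ (fun s => s - R) ⁻¹' tsupport u := by
      refine closure_minimal (fun s hs => subset_tsupport u hs)
        ((isClosed_tsupport u).preimage (by fun_prop))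
    intro s hs
    have := (hR' (this hs)).1
    simp only [mem_Ioi] at *
    linarith
  have h1 := H v _ _ (sys.XX_isSol hv hcv) (sys.XX_zero' hsv) hv hcv hsv M (fun s => hM _) R hR.le
  rw [← sys.Th_shift v R] at h1
  simpa [v] using h1

lemma Th_zero (sys : SystemNode U X Xm1 Y) {u : ℝ → U} (h : tsupport u ⊆ Ioi 0) :
    sys.Th u = 0 := by
  have h1 : (0:ℝ) ∉ tsupport u := fun hs' => lt_irrefl (0:ℝ) (h hs')
  rw [Th, sys.XX_zero' h, image_eq_zero_of_notMem_tsupport h1]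
  have := sys.CD_smul 0 (x₁ := 0) (u₁ := 0) (z₁ := 0) (by simp)
  simpa using this

end SystemNode


open BoundedContinuousFunction in
/-- smooth compactly supported scalar functions. -/
noncomputable def smoothCS : Submodule ℂ (ℝ →ᵇ ℂ) where
  carrier := {f | ContDiff ℝ (⊤ : ℕ∞) f ∧ HasCompactSupport f}
  add_mem' := fun ha hb => ⟨ha.1.add hb.1, ha.2.add hb.2⟩
  zero_mem' := ⟨contDiff_const, HasCompactSupport.zero⟩
  smul_mem' := fun c f hf => ⟨hf.1.const_smul c, hf.2.smul_left (f := fun _ => c)⟩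

open BoundedContinuousFunction in
/-- bundling of a smooth compactly supported function. -/
noncomputable def mkCS (φ : ℝ → ℂ) (h : ContDiff ℝ (⊤ : ℕ∞) φ) (hc : HasCompactSupport φ) :
    smoothCS :=
  ⟨BoundedContinuousFunction.mkOfBound ⟨φ, h.continuous⟩
    (2 * (hc.exists_bound_of_continuous h.continuous).choose) (by
      intro x y
      have H := (hc.exists_bound_of_continuous h.continuous).choose_spec
      rw [dist_eq_norm]
      refine (norm_sub_le _ _).trans ?_
      have h1 := H x
      have h2 := H y
      simp only [ContinuousMap.coe_mk]
      linarith), h, hc⟩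

namespace SystemNode

variable {U X Xm1 Y : Type*}
  [NormedAddCommGroup U] [NormedSpace ℂ U] [FiniteDimensional ℂ U]
  [NormedAddCommGroup X] [NormedSpace ℂ X] [CompleteSpace X]
  [NormedAddCommGroup Xm1] [NormedSpace ℂ Xm1] [CompleteSpace Xm1]
  [NormedAddCommGroup Y] [NormedSpace ℂ Y]

lemma lam_smooth {φ : ℝ → ℂ} (h : ContDiff ℝ (⊤ : ℕ∞) φ) (e : U) :
    ContDiff ℝ (⊤ : ℕ∞) (fun s => φ (-s) • e) :=
  (h.comp contDiff_neg).smul contDiff_const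

lemma lam_supp {φ : ℝ → ℂ} (h : HasCompactSupport φ) (e : U) :
    HasCompactSupport (fun s => φ (-s) • e) :=
  (h.comp_homeomorph (Homeomorph.neg ℝ)).smul_right (f' := fun _ => e)

/-- the operator valued functional. -/
noncomputable def lam (sys : SystemNode U X Xm1 Y) : smoothCS →ₗ[ℂ] (U →L[ℂ] Y) where
  toFun f := LinearMap.toContinuousLinearMap
    { toFun := fun e => sys.Th (fun s => f.1 (-s) • e)
      map_add' := fun a b => by
        have := sys.Th_add (lam_smooth f.2.1 a) (lam_supp f.2.2 a) (lam_smooth f.2.1 b)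
          (lam_supp f.2.2 b)
        simpa only [smul_add] using this
      map_smul' := fun a b => by
        have := sys.Th_smul a (lam_smooth f.2.1 b) (lam_supp f.2.2 b)
        simp only [smul_comm a] at this
        exact this }
  map_add' f k := by
    ext e
    have := sys.Th_add (lam_smooth f.2.1 e) (lam_supp f.2.2 e) (lam_smooth k.2.1 e)
          (lam_supp k.2.2 e)
    simp only [← add_smul] at this
    exact this
  map_smul' a f := by
    ext e
    have := sys.Th_smul a (lam_smooth f.2.1 e) (lam_supp f.2.2 e)
    simp only [smul_smul] at this
    exact this

lemma lam_apply (sys : SystemNode U X Xm1 Y) (f : smoothCS) (e : U) :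
    sys.lam f e = sys.Th (fun s => f.1 (-s) • e) := rfl

lemma Th_sum (sys : SystemNode U X Xm1 Y) {ι' : Type*} (I : Finset ι') (w : ι' → ℝ → U)
    (h : ∀ i, ContDiff ℝ (⊤ : ℕ∞) (w i)) (hc : ∀ i, HasCompactSupport (w i)) :
    sys.Th (fun s => ∑ i ∈ I, w i s) = ∑ i ∈ I, sys.Th (w i) := by
  classical
  induction I using Finset.induction_on with
  | empty =>
    simp only [Finset.sum_empty]
    apply sys.Th_zero
    have : tsupport (fun _ : ℝ => (0:U)) = ∅ := tsupport_eq_empty_iff.2 rfl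
    rw [this]
    exact empty_subset _
  | insert i I hi ih =>
    have h1 : ContDiff ℝ (⊤ : ℕ∞) (fun s => ∑ i ∈ I, w i s) := ContDiff.sum fun i _ => h i
    have h2 : HasCompactSupport (fun s => ∑ i ∈ I, w i s) := by
      clear ih hi h1
      induction I using Finset.induction_on with
      | empty => simp only [Finset.sum_empty]; exact HasCompactSupport.zero
      | insert j J hj ih =>
        simp only [Finset.sum_insert hj]
        exact (hc j).add ih
    simp only [Finset.sum_insert hi]
    rw [sys.Th_add (h i) (hc i) h1 h2, ih]

lemma exists_repr [FiniteDimensional ℂ Y] (sys : SystemNode U X Xm1 Y)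
    (hb : sys.CInfBIBOStable) :
    ∃ (μ : Measure ℝ) (g : ℝ → U →L[ℂ] Y), IsFiniteMeasure μ ∧ Integrable g μ ∧
      (∀ᵐ s ∂μ, s ∈ Iio (0:ℝ) → g s = 0) ∧
      ∀ u : ℝ → U, ContDiff ℝ (⊤ : ℕ∞) u → HasCompactSupport u → ∀ t : ℝ,
        sys.CD (sys.XX u t) (u t) = ∫ s, g s (u (t - s)) ∂μ := by
  obtain ⟨c, hc0, hc⟩ := sys.Th_bound hb
  obtain ⟨μ, g, hμ, hg, hrep⟩ := riesz_vec smoothCS (fun f hf => hf.2) sys.lam c (by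
    intro f
    refine ContinuousLinearMap.opNorm_le_bound _ (by positivity) fun e => ?_
    rw [lam_apply, mul_assoc]
    refine hc _ (lam_smooth f.2.1 e) (lam_supp f.2.2 e) _ fun s => ?_
    rw [norm_smul]
    gcongr
    exact f.1.norm_coe_le_norm _)
  have := hμ
  have hint : ∀ f : smoothCS, Integrable (fun s => f.1 s • g s) μ := fun f =>
    hg.bdd_smul ‖f.1‖ f.1.continuous.aestronglyMeasurable
      (ae_of_all _ fun s => f.1.norm_coe_le_norm s)
  refine ⟨μ, g, hμ, hg, ?_, ?_⟩
  · refine isOpen_Iio.ae_eq_zero_of_integral_contDiff_smul_eq_zero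
      (hg.locallyIntegrable.locallyIntegrableOn _) fun φ hφ hφc hφs => ?_
    have h1 : ContDiff ℝ (⊤ : ℕ∞) (fun s => (φ s : ℂ)) :=
      Complex.ofRealCLM.contDiff.comp hφ
    have h2 : HasCompactSupport (fun s => (φ s : ℂ)) := hφc.comp_left Complex.ofReal_zero
    have h3 := hrep (mkCS _ h1 h2)
    have h4 : sys.lam (mkCS _ h1 h2) = 0 := by
      ext e
      rw [lam_apply]
      refine sys.Th_zero ?_
      have : tsupport (fun s => (mkCS _ h1 h2).1 (-s) • e) ⊆ (fun s => -s) ⁻¹' tsupport φ := by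
        refine closure_minimal (fun s hs => subset_tsupport φ ?_)
          ((isClosed_tsupport φ).preimage (by fun_prop))
        intro h0
        apply hs
        have : (mkCS _ h1 h2).1 (-s) = ((φ (-s) : ℝ) : ℂ) := rfl
        simp only [this, h0]
        simp
      intro s hs
      have := hφs (this hs)
      simpa using this
    rw [h4] at h3
    rw [h3]
    exact integral_congr_ae (ae_of_all _ fun s => (Complex.coe_smul (φ s) (g s)).symm)
  · intro u hu huc t
    let b := Module.finBasis ℂ U
    let co : ∀ i, U →L[ℂ] ℂ := fun i => LinearMap.toContinuousLinearMap (b.coord i)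
    have hdec : ∀ v : U, v = ∑ i, co i v • b i := fun v => (b.sum_repr v).symm
    have hs1 : ∀ i, ContDiff ℝ (⊤ : ℕ∞) (fun s => co i (u (t - s))) := fun i =>
      ((co i).restrictScalars ℝ).contDiff.comp (hu.comp (contDiff_const.sub contDiff_id))
    have hs2 : ∀ i, HasCompactSupport (fun s => co i (u (t - s))) := fun i =>
      (huc.comp_homeomorph (Homeomorph.subLeft t)).comp_left (map_zero (co i))
    have e1 : (fun s => u (s + t)) =
        fun s => ∑ i, (mkCS _ (hs1 i) (hs2 i)).1 (-s) • b i := by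
      ext s
      have : ∀ i, (mkCS _ (hs1 i) (hs2 i)).1 (-s) = co i (u (t - -s)) := fun i => rfl
      simp only [this]
      rw [← hdec]
      congr 1
      ring
    rw [← sys.Th_shift, e1, sys.Th_sum _ (fun i s => (mkCS _ (hs1 i) (hs2 i)).1 (-s) • b i)
      (fun i => lam_smooth (hs1 i) _)
      (fun i => lam_supp (hs2 i) _)]
    have e2 : ∀ i, sys.Th (fun s => (mkCS _ (hs1 i) (hs2 i)).1 (-s) • b i) =
        ∫ s, co i (u (t - s)) • g s (b i) ∂μ := by
      intro i
      rw [← lam_apply, hrep]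
      exact ContinuousLinearMap.integral_apply (hint (mkCS _ (hs1 i) (hs2 i))) (b i)
    rw [Finset.sum_congr rfl fun i _ => e2 i, ← integral_finsetSum]
    · refine integral_congr_ae (ae_of_all _ fun s => ?_)
      simp only
      conv_rhs => rw [hdec (u (t - s))]
      simp only [map_sum, map_smul]
    · intro i _
      exact (hint (mkCS _ (hs1 i) (hs2 i))).apply_continuousLinearMap (b i)

end SystemNode


lemma exists_polar {U Y : Type*} [NormedAddCommGroup U] [NormedSpace ℂ U] [FiniteDimensional ℂ U]
    [NormedAddCommGroup Y] [NormedSpace ℂ Y] [FiniteDimensional ℂ Y]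
    (μ : Measure ℝ) (g : ℝ → U →L[ℂ] Y) (hμ : IsFiniteMeasure μ) (hg : Integrable g μ)
    (h0 : ∀ᵐ s ∂μ, s ∈ Iio (0:ℝ) → g s = 0) :
    ∃ h : BVMeasure U Y, ∀ (S : Set ℝ), MeasurableSet S → ∀ f : ℝ → U,
      ∫ s in S, h.g s (f s) ∂h.μ = ∫ s in S, g s (f s) ∂μ := by
  let g₁ := hg.1.mk g
  have hm : StronglyMeasurable g₁ := hg.1.stronglyMeasurable_mk
  have he : g =ᵐ[μ] g₁ := hg.1.ae_eq_mk
  have hn : Measurable (fun s => ‖g₁ s‖₊) := hm.nnnorm.measurable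
  let ν := μ.withDensity (fun s => (‖g₁ s‖₊ : ℝ≥0∞))
  have hfin : IsFiniteMeasure ν := by
    refine isFiniteMeasure_withDensity ?_
    exact (hg.congr he).2.ne
  refine ⟨⟨ν, hfin, ?_, fun s => ((‖g₁ s‖⁻¹ : ℝ) : ℂ) • g₁ s, ?_, ?_⟩, ?_⟩
  · rw [withDensity_apply _ measurableSet_Iio, lintegral_eq_zero_iff hn.coe_nnreal_ennreal]
    rw [Filter.EventuallyEq, ae_restrict_iff' measurableSet_Iio]
    filter_upwards [h0, he] with s h1 h2 hs
    simp [← h2, h1 hs]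
  · exact ((Complex.continuous_ofReal.measurable.comp
      hm.norm.measurable.inv).stronglyMeasurable.smul hm).aestronglyMeasurable
  · rw [ae_withDensity_iff hn.coe_nnreal_ennreal]
    refine ae_of_all _ fun s hs => ?_
    have : ‖g₁ s‖ ≠ 0 := by
      intro h
      apply hs
      simpa using h
    rw [norm_smul, Complex.norm_real, norm_inv, norm_norm, inv_mul_cancel₀ this]
  · intro S hS f
    simp only [ν]
    rw [setIntegral_withDensity_eq_setIntegral_smul hn _ hS]
    refine setIntegral_congr_ae hS ?_
    filter_upwards [he] with s hs _
    rw [hs]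
    by_cases h : g₁ s = 0
    · simp [h]
    · have : ‖g₁ s‖ ≠ 0 := by simpa using h
      simp only [ContinuousLinearMap.smul_apply]
      rw [Complex.coe_smul, NNReal.smul_def, smul_smul, coe_nnnorm, mul_inv_cancel₀ this, one_smul]


lemma exists_moll (ε : ℝ) (hε : 0 < ε) : ∃ ρ : ℝ → ℝ, ContDiff ℝ (⊤ : ℕ∞) ρ ∧
    HasCompactSupport ρ ∧ (∀ s, 0 ≤ ρ s) ∧ (∀ s, s ≤ ε / 4 → ρ s = 0) ∧ (∀ s, ε ≤ s → ρ s = 0) ∧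
    ∫ s, ρ s = 1 := by
  let φ : ContDiffBump (ε / 2) := ⟨ε / 8, ε / 4, by positivity, by linarith⟩
  have hs : ∀ s, s ∉ Metric.ball (ε / 2) (ε / 4) → φ.normed volume s = 0 := by
    intro s hs
    by_contra h
    have : s ∈ Function.support (φ.normed volume) := h
    rw [φ.support_normed_eq] at this
    exact hs this
  refine ⟨φ.normed volume, φ.contDiff_normed, φ.hasCompactSupport_normed, φ.nonneg_normed,
    fun s h => hs s ?_, fun s h => hs s ?_, φ.integral_normed⟩
  · rw [Metric.mem_ball, Real.dist_eq, abs_lt]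
    intro h'
    linarith [h'.1]
  · rw [Metric.mem_ball, Real.dist_eq, abs_lt]
    intro h'
    linarith [h'.2]

section mol
variable {Z : Type*} [NormedAddCommGroup Z] [NormedSpace ℝ Z]

/-- mollification. -/
noncomputable def mol (ρ : ℝ → ℝ) (f : ℝ → Z) (t : ℝ) : Z := ∫ r, ρ r • f (t - r)

lemma mol_eq (ρ : ℝ → ℝ) (f : ℝ → Z) :
    mol ρ f = convolution ρ f (ContinuousLinearMap.lsmul ℝ ℝ) volume := rfl

lemma mol_int {ρ : ℝ → ℝ} {f : ℝ → Z} (hρ : Continuous ρ) (hc : HasCompactSupport ρ)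
    (hf : LocallyIntegrable f volume) (t : ℝ) : Integrable (fun r => ρ r • f (t - r)) :=
  hc.convolutionExists_left (ContinuousLinearMap.lsmul ℝ ℝ) hρ hf t

lemma mol_interval {ρ : ℝ → ℝ} {f f₀ : ℝ → Z} {t : ℝ} (ht : 0 ≤ t) (hρ : ∀ r ≤ 0, ρ r = 0)
    (hf : ∀ s < 0, f s = 0) (hf₀ : ∀ s ∈ Icc 0 t, f s = f₀ s) :
    mol ρ f t = ∫ r in (0:ℝ)..t, ρ r • f₀ (t - r) := by
  have hz : ∀ r ∉ Ioc (0:ℝ) t, ρ r • f (t - r) = 0 := by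
    intro r hr
    by_cases h : r ≤ 0
    · simp [hρ r h]
    · have : t < r := by
        by_contra h'
        exact hr ⟨not_le.1 h, not_lt.1 h'⟩
      simp [hf (t - r) (by linarith)]
  rw [mol, ← setIntegral_eq_integral_of_forall_compl_eq_zero hz,
    intervalIntegral.integral_of_le ht]
  refine setIntegral_congr_fun measurableSet_Ioc fun r hr => ?_
  rw [hf₀ (t - r) ⟨by linarith [hr.2], by linarith [hr.1]⟩]

lemma mol_ibp [CompleteSpace Z] {ρ : ℝ → ℝ} {x x' : ℝ → Z} {t : ℝ} (ht : 0 ≤ t)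
    (hρ : ContDiff ℝ 1 ρ) (hρ0 : ρ 0 = 0)
    (hx : ∀ s ∈ Ici (0:ℝ), HasDerivWithinAt x (x' s) (Ici 0) s)
    (hx' : ContinuousOn x' (Ici 0)) (hx0 : x 0 = 0) :
    (∫ r in (0:ℝ)..t, deriv ρ r • x (t - r)) = ∫ r in (0:ℝ)..t, ρ r • x' (t - r) := by
  have hmap : MapsTo (fun r => t - r) (Icc 0 t) (Ici 0) := fun r hr => by
    simpa using hr.2
  have c1 : ContinuousOn (fun r => x (t - r)) (Icc 0 t) :=
    ContinuousOn.comp (t := Ici 0) (fun s hs => (hx s hs).continuousWithinAt) (by fun_prop) hmap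
  have c2 : ContinuousOn (fun r => x' (t - r)) (Icc 0 t) :=
    ContinuousOn.comp (t := Ici 0) hx' (by fun_prop) hmap
  have c3 : Continuous (deriv ρ) := hρ.continuous_deriv le_rfl
  have i1 : IntervalIntegrable (fun r => deriv ρ r • x (t - r)) volume 0 t := by
    refine ContinuousOn.intervalIntegrable ?_
    rw [uIcc_of_le ht]
    exact c3.continuousOn.smul c1
  have i2 : IntervalIntegrable (fun r => ρ r • x' (t - r)) volume 0 t := by
    refine ContinuousOn.intervalIntegrable ?_
    rw [uIcc_of_le ht]
    exact hρ.continuous.continuousOn.smul c2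
  have main := intervalIntegral.integral_eq_sub_of_hasDerivAt_of_le ht
    (f := fun r => ρ r • x (t - r)) (f' := fun r => deriv ρ r • x (t - r) - ρ r • x' (t - r))
    (hρ.continuous.continuousOn.smul c1) ?_ (i1.sub i2)
  · rw [intervalIntegral.integral_sub i1 i2] at main
    simp only [sub_self, hx0, smul_zero, hρ0, zero_smul] at main
    exact sub_eq_zero.1 main
  · intro r hr
    have h1 : HasDerivAt x (x' (t - r)) (t - r) :=
      (hx (t - r) (by simpa using hr.2.le)).hasDerivAt (Ici_mem_nhds (by linarith [hr.2]))
    have h2 : HasDerivAt (fun s : ℝ => t - s) (-1) r := by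
      simpa using (hasDerivAt_id r).const_sub t
    have h3 := h1.scomp r h2
    rw [neg_smul, one_smul] at h3
    have h4 : HasDerivAt ρ (deriv ρ r) r := (hρ.differentiable one_ne_zero r).hasDerivAt
    have h5 := h4.smul h3
    rw [smul_neg, neg_add_eq_sub] at h5
    exact h5

lemma mol_norm_le {ρ : ℝ → ℝ} {f : ℝ → Z} {M : ℝ} (h0 : ∀ r, 0 ≤ ρ r) (h1 : ∫ r, ρ r = 1)
    (hf : ∀ s, ‖f s‖ ≤ M) (t : ℝ) : ‖mol ρ f t‖ ≤ M := by
  have hi : Integrable ρ := by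
    by_contra h
    rw [integral_undef h] at h1
    exact zero_ne_one h1
  have := norm_integral_le_of_norm_le (f := fun r => ρ r • f (t - r)) (hi.mul_const M)
    (ae_of_all _ fun r => by
      rw [norm_smul, Real.norm_of_nonneg (h0 r)]
      exact mul_le_mul_of_nonneg_left (hf _) (h0 r))
  rwa [integral_mul_const, h1, one_mul] at this

lemma mol_tendsto [CompleteSpace Z] {ρ : ℕ → ℝ → ℝ} {ε : ℕ → ℝ} {f : ℝ → Z} {a : ℝ}
    (hρ : ∀ n, Continuous (ρ n)) (hc : ∀ n, HasCompactSupport (ρ n))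
    (h0 : ∀ n r, 0 ≤ ρ n r) (h1 : ∀ n, ∫ r, ρ n r = 1)
    (hs : ∀ n, ∀ s ≤ 0, ρ n s = 0) (hs' : ∀ n s, ε n ≤ s → ρ n s = 0)
    (hε : Filter.Tendsto ε Filter.atTop (𝓝 0))
    (hf : LocallyIntegrable f volume) (hfa : ContinuousWithinAt f (Ici a) a) :
    Filter.Tendsto (fun n => mol (ρ n) f (a + ε n)) Filter.atTop (𝓝 (f a)) := by
  rw [Metric.tendsto_atTop']
  intro η hη
  rw [Metric.continuousWithinAt_iff] at hfa
  obtain ⟨δ, hδ, H⟩ := hfa (η / 2) (by positivity)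
  obtain ⟨N, hN⟩ := (Metric.tendsto_atTop'.1 hε) δ hδ
  refine ⟨N, fun n hn => ?_⟩
  have hi : Integrable (ρ n) := (hρ n).integrable_of_hasCompactSupport (hc n)
  have e : mol (ρ n) f (a + ε n) - f a = ∫ r, ρ n r • (f (a + ε n - r) - f a) := by
    simp only [smul_sub]
    rw [integral_sub (mol_int (hρ n) (hc n) hf _) (hi.smul_const _), integral_smul_const, h1 n,
      one_smul]
    rfl
  have hb : ∀ r, ‖ρ n r • (f (a + ε n - r) - f a)‖ ≤ ρ n r * (η / 2) := by
    intro r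
    by_cases h : ρ n r = 0
    · simp [h]
    have r0 : 0 < r := by
      by_contra h'
      exact h (hs n r (not_lt.1 h'))
    have r1 : r < ε n := by
      by_contra h'
      exact h (hs' n r (not_lt.1 h'))
    rw [norm_smul, Real.norm_of_nonneg (h0 n r)]
    refine mul_le_mul_of_nonneg_left ?_ (h0 n r)
    rw [← dist_eq_norm]
    refine (H (show a ≤ a + ε n - r by linarith) ?_).le
    have := hN n hn
    rw [Real.dist_eq, sub_zero] at this
    rw [Real.dist_eq, abs_lt]
    have := (abs_lt.1 this).2
    constructor <;> linarith
  have := norm_integral_le_of_norm_le (hi.mul_const (η / 2)) (ae_of_all _ hb)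
  rw [integral_mul_const, h1, one_mul] at this
  rw [dist_eq_norm, e]
  linarith

lemma locInt_hat {f : ℝ → Z} (hf : ContinuousOn f (Ici 0)) :
    LocallyIntegrable ((Ici (0:ℝ)).indicator f) volume := by
  rw [locallyIntegrable_iff]
  intro K hK
  rw [integrableOn_indicator_iff measurableSet_Ici]
  exact (hf.mono inter_subset_left).integrableOn_compact (hK.inter_left isClosed_Ici)

lemma rc_hat {f : ℝ → Z} (hf : ContinuousOn f (Ici 0)) {a : ℝ} (ha : 0 ≤ a) :
    ContinuousWithinAt ((Ici (0:ℝ)).indicator f) (Ici a) a := by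
  refine ((hf a ha).mono (Ici_subset_Ici.2 ha)).congr (fun s hs => ?_) ?_
  · exact indicator_of_mem (ha.trans hs) f
  · exact indicator_of_mem ha f

lemma locInt_hat2 {f : ℝ → Z} (hf : ContinuousOn f (Ici 0)) (T : ℝ) :
    Integrable ((Icc (0:ℝ) T).indicator f) volume := by
  rw [integrable_indicator_iff measurableSet_Icc]
  exact (hf.mono Icc_subset_Ici_self).integrableOn_compact isCompact_Icc

lemma rc_hat2 {f : ℝ → Z} (hf : ContinuousOn f (Ici 0)) {a T : ℝ} (ha : a < T) :
    ContinuousWithinAt ((Icc (0:ℝ) T).indicator f) (Ici a) a := by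
  by_cases h : 0 ≤ a
  · have h1 : ContinuousWithinAt f (Ici a) a := (hf a h).mono (Ici_subset_Ici.2 h)
    have hm : a ∈ Icc 0 T := ⟨h, ha.le⟩
    refine h1.congr_of_eventuallyEq ?_ (indicator_of_mem hm f)
    filter_upwards [self_mem_nhdsWithin, mem_nhdsWithin_of_mem_nhds (Iio_mem_nhds ha)] with s h1 h2
    have hm' : s ∈ Icc 0 T := ⟨h.trans h1, le_of_lt h2⟩
    exact indicator_of_mem hm' f
  · have h2 : ContinuousWithinAt (fun _ : ℝ => (0:Z)) (Ici a) a := continuousWithinAt_const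
    have key : ∀ s < 0, (Icc (0:ℝ) T).indicator f s = 0 := fun s hs =>
      indicator_of_notMem (fun h' => absurd h'.1 (not_le.2 hs)) f
    refine h2.congr_of_eventuallyEq ?_ (key a (not_le.1 h))
    filter_upwards [mem_nhdsWithin_of_mem_nhds (Iio_mem_nhds (not_le.1 h))] with s h1
    exact key s h1

end mol


namespace SystemNode

variable {U X Xm1 Y : Type*}
  [NormedAddCommGroup U] [NormedSpace ℂ U] [FiniteDimensional ℂ U]
  [NormedAddCommGroup X] [NormedSpace ℂ X] [CompleteSpace X]
  [NormedAddCommGroup Xm1] [NormedSpace ℂ Xm1] [CompleteSpace Xm1]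
  [NormedAddCommGroup Y] [NormedSpace ℂ Y]

lemma mol_dom (sys : SystemNode U X Xm1 Y) {u : ℝ → U} {x x' : ℝ → X}
    (hu : ContinuousOn u (Ici 0)) (hx : ContinuousOn x (Ici 0)) (hx' : ContinuousOn x' (Ici 0))
    (hA : ∀ t ∈ Ici (0:ℝ), sys.Am1 (x t) + sys.B (u t) = sys.ι (x' t))
    {ρ : ℝ → ℝ} (hρ : Continuous ρ) (hρ0 : ∀ r ≤ 0, ρ r = 0) {T t : ℝ} (ht : 0 ≤ t) (htT : t ≤ T) :
    sys.Am1 (mol ρ ((Ici (0:ℝ)).indicator x) t) + sys.B (mol ρ ((Icc (0:ℝ) T).indicator u) t) =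
      sys.ι (mol ρ ((Ici (0:ℝ)).indicator x') t) := by
  have hU : CompleteSpace U := FiniteDimensional.complete ℂ U
  have neg : ∀ s < (0:ℝ), s ∉ Ici (0:ℝ) := fun s hs h => absurd h (not_le.2 hs)
  rw [mol_interval (f₀ := x) ht hρ0 (fun s hs => indicator_of_notMem (neg s hs) _)
      (fun s hs => indicator_of_mem (show s ∈ Ici (0:ℝ) from hs.1) _),
    mol_interval (f₀ := x') ht hρ0 (fun s hs => indicator_of_notMem (neg s hs) _)
      (fun s hs => indicator_of_mem (show s ∈ Ici (0:ℝ) from hs.1) _),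
    mol_interval (f₀ := u) (f := (Icc (0:ℝ) T).indicator u) ht hρ0
      (fun s hs => indicator_of_notMem (fun h => neg s hs h.1) _)
      (fun s hs => indicator_of_mem (show s ∈ Icc (0:ℝ) T from ⟨hs.1, hs.2.trans htT⟩) _)]
  have hmap : MapsTo (fun r => t - r) (Icc 0 t) (Ici 0) := fun r hr => by
    simpa using hr.2
  have key : ∀ {Z : Type _} [NormedAddCommGroup Z] [NormedSpace ℂ Z] {f : ℝ → Z},
      ContinuousOn f (Ici 0) → IntervalIntegrable (fun r => ρ r • f (t - r)) volume 0 t := by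
    intro Z _ _ f hf
    refine ContinuousOn.intervalIntegrable ?_
    rw [uIcc_of_le ht]
    exact hρ.continuousOn.smul (ContinuousOn.comp (t := Ici 0) hf (by fun_prop) hmap)
  have i1 := key hx
  have i2 : IntervalIntegrable (fun r => ρ r • u (t - r)) volume 0 t := by
    refine ContinuousOn.intervalIntegrable ?_
    rw [uIcc_of_le ht]
    exact hρ.continuousOn.smul (ContinuousOn.comp (t := Ici 0) hu (by fun_prop) hmap)
  have i3 := key hx'
  rw [← sys.Am1.intervalIntegral_comp_comm i1, ← sys.ι.intervalIntegral_comp_comm i3,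
    ← sys.B.intervalIntegral_comp_comm i2]
  have j1 : IntervalIntegrable (fun r => sys.Am1 (ρ r • x (t - r))) volume 0 t :=
    ⟨sys.Am1.integrable_comp i1.1, sys.Am1.integrable_comp i1.2⟩
  have j2 : IntervalIntegrable (fun r => sys.B (ρ r • u (t - r))) volume 0 t :=
    ⟨sys.B.integrable_comp i2.1, sys.B.integrable_comp i2.2⟩
  rw [← intervalIntegral.integral_add j1 j2]
  refine intervalIntegral.integral_congr fun r hr => ?_
  rw [uIcc_of_le ht] at hr
  simp only [← Complex.coe_smul, map_smul]
  rw [← smul_add, hA _ (hmap hr)]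

lemma mol_CD (sys : SystemNode U X Xm1 Y) {u : ℝ → U} {x x' : ℝ → X}
    (hu : ContinuousOn u (Ici 0)) (hx' : ContinuousOn x' (Ici 0))
    (hd : ∀ t ∈ Ici (0:ℝ), HasDerivWithinAt x (x' t) (Ici 0) t)
    (hA : ∀ t ∈ Ici (0:ℝ), sys.Am1 (x t) + sys.B (u t) = sys.ι (x' t)) (hx0 : x 0 = 0)
    {ρ : ℝ → ℝ} (hρ : ContDiff ℝ (⊤ : ℕ∞) ρ) (hρc : HasCompactSupport ρ) {δ : ℝ} (hδ : 0 < δ)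
    (hρ0 : ∀ r ≤ δ, ρ r = 0) {T t : ℝ} (ht : 0 ≤ t) (htT : t ≤ T) :
    ContDiff ℝ (⊤ : ℕ∞) (mol ρ ((Icc (0:ℝ) T).indicator u)) ∧
    HasCompactSupport (mol ρ ((Icc (0:ℝ) T).indicator u)) ∧
    mol ρ ((Ici (0:ℝ)).indicator x) t = sys.XX (mol ρ ((Icc (0:ℝ) T).indicator u)) t := by
  have hx : ContinuousOn x (Ici 0) := fun s hs => (hd s hs).continuousWithinAt
  have hρ1 : ContDiff ℝ 1 ρ := hρ.of_le (by exact_mod_cast le_top)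
  have hρ0' : ∀ r ≤ 0, ρ r = 0 := fun r hr => hρ0 r (hr.trans hδ.le)
  have neg : ∀ s < (0:ℝ), s ∉ Ici (0:ℝ) := fun s hs h => absurd h (not_le.2 hs)
  have s1 : ContDiff ℝ (⊤ : ℕ∞) (mol ρ ((Icc (0:ℝ) T).indicator u)) :=
    hρc.contDiff_convolution_left (ContinuousLinearMap.lsmul ℝ ℝ) hρ
      (locInt_hat2 hu T).locallyIntegrable
  have s2 : HasCompactSupport (mol ρ ((Icc (0:ℝ) T).indicator u)) := by
    refine HasCompactSupport.convolution (ContinuousLinearMap.lsmul ℝ ℝ) hρc ?_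
    exact HasCompactSupport.intro isCompact_Icc fun s hs => indicator_of_notMem hs _
  refine ⟨s1, s2, ?_⟩
  have s3 : tsupport (mol ρ ((Icc (0:ℝ) T).indicator u)) ⊆ Ioi 0 := by
    have : tsupport (mol ρ ((Icc (0:ℝ) T).indicator u)) ⊆ Ici δ := by
      refine closure_minimal (fun s hs => ?_) isClosed_Ici
      by_contra h
      have h' : s < δ := not_le.1 h
      apply hs
      refine integral_eq_zero_of_ae (ae_of_all _ fun r => ?_)
      by_cases hr : r ≤ δ
      · simp [hρ0 r hr]
      · have : (Icc (0:ℝ) T).indicator u (s - r) = 0 :=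
          indicator_of_notMem (fun h => by have := h.1; linarith [not_le.1 hr]) _
        simp [this]
    exact fun s hs => lt_of_lt_of_le hδ (this hs)
  have hder : ∀ τ, 0 ≤ τ → HasDerivAt (mol ρ ((Ici (0:ℝ)).indicator x))
      (mol ρ ((Ici (0:ℝ)).indicator x') τ) τ := by
    intro τ hτ
    have h1 : HasDerivAt (mol ρ ((Ici (0:ℝ)).indicator x))
        (mol (deriv ρ) ((Ici (0:ℝ)).indicator x) τ) τ :=
      hρc.hasDerivAt_convolution_left (ContinuousLinearMap.lsmul ℝ ℝ) hρ1 (locInt_hat hx) τ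
    have h2 : mol (deriv ρ) ((Ici (0:ℝ)).indicator x) τ =
        mol ρ ((Ici (0:ℝ)).indicator x') τ := by
      have d0 : ∀ r ≤ 0, deriv ρ r = 0 := by
        intro r hr
        have : ρ =ᶠ[𝓝 r] fun _ => 0 := by
          filter_upwards [Iio_mem_nhds (hr.trans_lt hδ)] with s hs using hρ0 s (le_of_lt hs)
        rw [this.deriv_eq]
        simp
      rw [mol_interval (f₀ := x) hτ d0 (fun s hs => indicator_of_notMem (neg s hs) _)
        (fun s hs => indicator_of_mem (show s ∈ Ici (0:ℝ) from hs.1) _),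
        mol_interval (f₀ := x') hτ hρ0' (fun s hs => indicator_of_notMem (neg s hs) _)
        (fun s hs => indicator_of_mem (show s ∈ Ici (0:ℝ) from hs.1) _)]
      exact mol_ibp hτ hρ1 (hρ0' 0 le_rfl) hd hx' hx0
    rwa [h2] at h1
  have hdiff : ∀ τ, 0 ≤ τ → HasDerivAt
      (fun τ => mol ρ ((Ici (0:ℝ)).indicator x) τ - sys.XX (mol ρ ((Icc (0:ℝ) T).indicator u)) τ)
      (mol ρ ((Ici (0:ℝ)).indicator x') τ - sys.XX' (mol ρ ((Icc (0:ℝ) T).indicator u)) τ) τ :=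
    fun τ hτ => (hder τ hτ).sub (sys.XX_hasDerivAt s1 s2 τ)
  have := sys.uniq
    (fun τ => mol ρ ((Ici (0:ℝ)).indicator x) τ - sys.XX (mol ρ ((Icc (0:ℝ) T).indicator u)) τ)
    (fun τ => mol ρ ((Ici (0:ℝ)).indicator x') τ - sys.XX' (mol ρ ((Icc (0:ℝ) T).indicator u)) τ)
    t ht (fun τ hτ => (hdiff τ hτ.1).continuousAt.continuousWithinAt)
    (fun τ hτ => (hdiff τ hτ.1).hasDerivWithinAt) (fun τ hτ => ?_) ?_
  · exact sub_eq_zero.1 this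
  · have e1 := sys.mol_dom hu hx hx' hA hρ.continuous hρ0' hτ.1 (hτ.2.le.trans htT)
    have e2 := sys.XX_dom s1 s2 τ
    simp only [map_sub]
    rw [← e1, ← e2]
    abel
  · rw [sys.XX_zero' s3, mol_interval (f₀ := x) le_rfl hρ0'
      (fun s hs => indicator_of_notMem (neg s hs) _)
      (fun s hs => indicator_of_mem (show s ∈ Ici (0:ℝ) from hs.1) _)]
    simp

lemma conv_main [CompleteSpace Y] (sys : SystemNode U X Xm1 Y) {μ : Measure ℝ} {g : ℝ → U →L[ℂ] Y}
    (hμ : IsFiniteMeasure μ) (hg : Integrable g μ) (hg0 : ∀ᵐ s ∂μ, s ∈ Iio (0:ℝ) → g s = 0)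
    (hrep : ∀ u : ℝ → U, ContDiff ℝ (⊤ : ℕ∞) u → HasCompactSupport u → ∀ t : ℝ,
        sys.CD (sys.XX u t) (u t) = ∫ s, g s (u (t - s)) ∂μ)
    {u : ℝ → U} {x x' : ℝ → X}
    (hu : ContinuousOn u (Ici 0)) (hx' : ContinuousOn x' (Ici 0))
    (hd : ∀ t ∈ Ici (0:ℝ), HasDerivWithinAt x (x' t) (Ici 0) t)
    (hA : ∀ t ∈ Ici (0:ℝ), sys.Am1 (x t) + sys.B (u t) = sys.ι (x' t)) (hx0 : x 0 = 0)
    {t : ℝ} (ht : 0 ≤ t) :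
    sys.CD (x t) (u t) = ∫ s in Icc 0 t, g s (u (t - s)) ∂μ := by
  have hU : CompleteSpace U := FiniteDimensional.complete ℂ U
  have hx : ContinuousOn x (Ici 0) := fun s hs => (hd s hs).continuousWithinAt
  let ε : ℕ → ℝ := fun n => 1 / ((n:ℝ) + 1)
  have hε0 : ∀ n, 0 < ε n := fun n => Nat.one_div_pos_of_nat
  have hε1 : ∀ n, ε n ≤ 1 := fun n => by
    simp only [ε]
    rw [div_le_one (by positivity)]
    linarith [(Nat.cast_nonneg n : (0:ℝ) ≤ n)]
  have hε : Filter.Tendsto ε Filter.atTop (𝓝 0) := tendsto_one_div_add_atTop_nhds_zero_nat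
  choose ρ hρ hρc hρn hρl hρr hρ1 using fun n => exists_moll (ε n) (hε0 n)
  have hρl' : ∀ n, ∀ s ≤ 0, ρ n s = 0 := fun n s hs => hρl n s (by linarith [hε0 n])
  let û := (Icc (0:ℝ) (t + 1)).indicator u
  have hûi : LocallyIntegrable û volume := (locInt_hat2 hu (t + 1)).locallyIntegrable
  have lim : ∀ a < t + 1, Filter.Tendsto (fun n => mol (ρ n) û (a + ε n)) Filter.atTop
      (𝓝 (û a)) := fun a ha =>
    mol_tendsto (fun n => (hρ n).continuous) hρc hρn hρ1 hρl' hρr hε hûi (rc_hat2 hu ha)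
  have limx := mol_tendsto (fun n => (hρ n).continuous) hρc hρn hρ1 hρl' hρr hε
    (locInt_hat hx) (rc_hat hx ht)
  have limx' := mol_tendsto (fun n => (hρ n).continuous) hρc hρn hρ1 hρl' hρr hε
    (locInt_hat hx') (rc_hat hx' ht)
  rw [indicator_of_mem (show t ∈ Ici (0:ℝ) from ht)] at limx limx'
  have hut : û t = u t := indicator_of_mem (show t ∈ Icc (0:ℝ) (t + 1) from ⟨ht, by linarith⟩) _
  have limu := lim t (by linarith)
  rw [hut] at limu
  have L1 := sys.CD_tendsto (l := Filter.atTop)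
    (Filter.Eventually.of_forall fun n => sys.mol_dom (T := t + 1) (t := t + ε n) hu hx hx' hA
      (hρ n).continuous (hρl' n) (by linarith [hε0 n]) (by linarith [hε1 n]))
    (hA t ht) limx limx' limu
  have eq : ∀ n, sys.CD (mol (ρ n) ((Ici (0:ℝ)).indicator x) (t + ε n)) (mol (ρ n) û (t + ε n)) =
      ∫ s, g s (mol (ρ n) û (t + ε n - s)) ∂μ := by
    intro n
    obtain ⟨s1, s2, s3⟩ := sys.mol_CD hu hx' hd hA hx0 (hρ n) (hρc n)
      (by linarith [hε0 n] : 0 < ε n / 4) (hρl n) (T := t + 1) (t := t + ε n)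
      (by linarith [hε0 n]) (by linarith [hε1 n])
    rw [s3]
    exact hrep _ s1 s2 _
  obtain ⟨M, hM⟩ := isCompact_Icc.exists_bound_of_continuousOn
    (hu.mono (Icc_subset_Ici_self : Icc (0:ℝ) (t + 1) ⊆ Ici 0))
  have hM' : ∀ s, ‖û s‖ ≤ M := by
    intro s
    by_cases hs : s ∈ Icc (0:ℝ) (t + 1)
    · simp only [û, indicator_of_mem hs]
      exact hM s hs
    · simp only [û, indicator_of_notMem hs, norm_zero]
      exact (norm_nonneg _).trans (hM t ⟨ht, by linarith⟩)
  have L2 : Filter.Tendsto (fun n => ∫ s, g s (mol (ρ n) û (t + ε n - s)) ∂μ) Filter.atTop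
      (𝓝 (∫ s, g s (û (t - s)) ∂μ)) := by
    refine tendsto_integral_of_dominated_convergence (fun s => ‖g s‖ * M) (fun n => ?_)
      (hg.norm.mul_const M) (fun n => ae_of_all _ fun s => ?_) ?_
    · obtain ⟨s1, -, -⟩ := sys.mol_CD hu hx' hd hA hx0 (hρ n) (hρc n)
        (by linarith [hε0 n] : 0 < ε n / 4) (hρl n) (T := t + 1) (t := t)
        ht (by linarith)
      have c : Continuous (fun s => mol (ρ n) û (t + ε n - s)) :=
        s1.continuous.comp (by fun_prop)
      exact (evL U Y).aestronglyMeasurable_comp₂ hg.1 c.aestronglyMeasurable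
    · refine ((g s).le_opNorm _).trans ?_
      gcongr
      exact mol_norm_le (hρn n) (hρ1 n) hM' _
    · filter_upwards [hg0] with s hs
      by_cases h : s ∈ Iio (0:ℝ)
      · simp [hs h]
      · have h' : 0 ≤ s := not_lt.1 h
        have := lim (t - s) (by linarith)
        have e : ∀ n, t + ε n - s = t - s + ε n := fun n => by ring
        simp only [e]
        exact ((g s).continuous.tendsto _).comp this
  have L3 := tendsto_nhds_unique (L1.congr eq) L2
  rw [L3, ← integral_indicator measurableSet_Icc]
  refine integral_congr_ae ?_
  filter_upwards [hg0] with s hs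
  by_cases h : s ∈ Icc 0 t
  · rw [indicator_of_mem h]
    have hm : t - s ∈ Icc (0:ℝ) (t + 1) := ⟨by linarith [h.2], by linarith [h.1]⟩
    simp only [û, indicator_of_mem hm]
  · rw [indicator_of_notMem h]
    by_cases h0 : s < 0
    · simp [hs h0]
    · have : t < s := by
        by_contra h'
        exact h ⟨not_lt.1 h0, not_lt.1 h'⟩
      have hm : t - s ∉ Icc (0:ℝ) (t + 1) := fun hh => by linarith [hh.1]
      simp [û, indicator_of_notMem hm]

end SystemNode

/-- Proposition 3.9: for a `C^∞`-BIBO stable system node with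
finite-dimensional input and output spaces there is a measure `h` of bounded total
variation on `[0,∞)` such that *every* classical solution with zero initial state
(with merely continuous input) satisfies `y = h ∗ u`, and consequently
`‖y‖_{L^∞([0,T])} ≤ ‖h‖_M ‖u‖_{L^∞([0,T])}` for all `T ≥ 0`. -/
theorem cInfBIBO_all_classical_solutions_convolution
    {U X Xm1 Y : Type*}
    [NormedAddCommGroup U] [NormedSpace ℂ U] [FiniteDimensional ℂ U]
    [NormedAddCommGroup X] [NormedSpace ℂ X] [CompleteSpace X]
    [NormedAddCommGroup Xm1] [NormedSpace ℂ Xm1] [CompleteSpace Xm1]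
    [NormedAddCommGroup Y] [NormedSpace ℂ Y] [FiniteDimensional ℂ Y]
    (sys : SystemNode U X Xm1 Y)
    (hbibo : sys.CInfBIBOStable) :
    ∃ h : BVMeasure U Y,
      ∀ (u : ℝ → U) (x : ℝ → X) (y : ℝ → Y),
        sys.IsClassicalSolution u x y → x 0 = 0 →
        (∀ t : ℝ, 0 ≤ t → y t = h.conv u t) ∧
        (∀ T : ℝ, 0 ≤ T → ∀ M : ℝ, (∀ s ∈ Set.Icc (0:ℝ) T, ‖u s‖ ≤ M) →
          ∀ t ∈ Set.Icc (0:ℝ) T, ‖y t‖ ≤ h.var * M) := by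
  obtain ⟨μ, g, hμ, hg, hg0, hrep⟩ := sys.exists_repr hbibo
  obtain ⟨h, hh⟩ := exists_polar μ g hμ hg hg0
  have hY : CompleteSpace Y := FiniteDimensional.complete ℂ Y
  refine ⟨h, fun u x y hsol hx0 => ?_⟩
  obtain ⟨hu, -, ⟨x', hx', hd, hA⟩, hy⟩ := hsol
  have key : ∀ t : ℝ, 0 ≤ t → y t = h.conv u t := by
    intro t ht
    rw [hy t ht, sys.conv_main hμ hg hg0 hrep hu hx' hd hA hx0 ht, BVMeasure.conv,
      hh _ measurableSet_Icc]
  refine ⟨key, fun T hT M hM t ht => ?_⟩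
  have hM0 : 0 ≤ M := (norm_nonneg _).trans (hM 0 ⟨le_rfl, hT⟩)
  rw [key t ht.1, BVMeasure.conv]
  have hfin := h.finite
  have hb : ∀ᵐ s ∂h.μ.restrict (Set.Icc 0 t), ‖h.g s (u (t - s))‖ ≤ M := by
    rw [ae_restrict_iff' measurableSet_Icc]
    filter_upwards [h.g_norm] with s hs hst
    refine ((h.g s).le_opNorm _).trans ?_
    rw [hs, one_mul]
    exact hM _ ⟨by linarith [hst.2], by linarith [hst.1, ht.2]⟩
  refine (norm_integral_le_of_norm_le_const hb).trans ?_
  rw [mul_comm, BVMeasure.var]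
  refine mul_le_mul_of_nonneg_right ?_ hM0
  rw [Measure.real, Measure.restrict_apply_univ]
  exact ENNReal.toReal_mono (measure_ne_top _ _) (measure_mono (Set.subset_univ _))
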